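/- arXiv:1507.03076 — 2 statements merged into one kernel-verified Lean document; each statement's English description precedes it below -/
import Mathlib

section
/- The pseudovariety A of finite aperiodic semigroups is κ-reducible for pointlike sets: let S be a finite semigroup and P an A-pointlike subset of S. Then for every finite alphabet A and every surjective homomorphism φ: A⁺ → S from the free semigroup on A, there exists a family (w_p)_{p∈P} of κ-terms over A such that, for each p ∈ P, w_p evaluates to p in S under the letter assignment given by φ restricted to A, and for every finite aperiodic semigroup T and every map from A to T, all the terms w_p evaluate to one and the same element of T. -/
/-- `spow s n` is the power `s^(n+1)` of `s`, defined in any magma. -/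
def spow {S : Type*} [Mul S] (s : S) (n : ℕ) : S := (fun x => x * s)^[n] s

/-- A finite semigroup is aperiodic if for every element `s` there is `m` with
`s^m = s^(m+1)`. -/
def IsAperiodic (T : Type) [Semigroup T] : Prop :=
  ∀ t : T, ∃ m : ℕ, spow t m = spow t (m + 1)

/-- κ-terms over the alphabet `A`: letters, binary multiplication and the
unary `(ω-1)`-power. -/
inductive KTerm (A : Type) : Type
  | letter : A → KTerm A
  | mul : KTerm A → KTerm A → KTerm A
  | ommPow : KTerm A → KTerm A

/-- The evaluation relation for κ-terms in a semigroup `T`, given an assignment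
`f` of letters.  The `(ω-1)`-power of an element `s` is the element `g` of the
cyclic subsemigroup generated by `s` such that `g * s = s * g = e` and
`g * e = g`, where `e` is the (unique, in a finite semigroup) idempotent power
`s^ω` of `s`. -/
inductive KEval {A T : Type} [Semigroup T] (f : A → T) : KTerm A → T → Prop
  | letter (a : A) : KEval f (KTerm.letter a) (f a)
  | mul {u v : KTerm A} {s t : T} :
      KEval f u s → KEval f v t → KEval f (KTerm.mul u v) (s * t)
  | ommPow {u : KTerm A} {s e g : T} :
      KEval f u s →
      IsIdempotentElem e → (∃ n : ℕ, spow s n = e) →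
      (∃ n : ℕ, spow s n = g) →
      g * s = e → s * g = e → g * e = g →
      KEval f (KTerm.ommPow u) g

/-- `P` is pointlike for the pseudovariety of finite aperiodic semigroups:
for every finite aperiodic semigroup `T` and every subsemigroup `R` of `S × T`
projecting onto `S`, some `t ∈ T` is related to every element of `P`. -/
def IsAperiodicPointlike {S : Type} [Semigroup S] (P : Set S) : Prop :=
  ∀ (T : Type) [Semigroup T] [Finite T], IsAperiodic T →
    ∀ R : Subsemigroup (S × T),
      (∀ s : S, ∃ t : T, (s, t) ∈ R) →
      ∃ t : T, ∀ p ∈ P, (p, t) ∈ R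


/-- Aperiodicity for monoids. -/
def AperM (M : Type) [Monoid M] : Prop := ∀ m : M, ∃ n : ℕ, m ^ n = m ^ (n + 1)

/-- A product-closed set which contains, for each member, an upper bound of its large powers. -/
structure GoodSet {Q : Type*} [Monoid Q] [PartialOrder Q] (U : Set Q) : Prop where
  mul : ∀ x ∈ U, ∀ y ∈ U, x * y ∈ U
  bnd : ∀ x ∈ U, ∃ y ∈ U, ∃ N : ℕ, ∀ n, N ≤ n → x ^ n ≤ y

/-- Covering of a labelling by a finite aperiodic monoid. -/
def Covered {Q : Type*} [Monoid Q] [PartialOrder Q] (U : Set Q) {A : Type} (α : A → Q) : Prop :=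
  ∃ (M : Type) (_ : Monoid M) (_ : Finite M), AperM M ∧
    ∃ (h : FreeMonoid A →* M) (β : M → Q), (∀ m, β m ∈ U ∨ β m = 1) ∧
      ∀ w, FreeMonoid.lift α w ≤ β (h w)

/-! ### Truncated counting monoid -/

/-- The monoid of natural numbers truncated at `N`. -/
structure CntMon (N : ℕ) where
  val : ℕ
  le : val ≤ N

theorem CntMon.ext' {N : ℕ} {x y : CntMon N} (h : x.val = y.val) : x = y := by
  cases x; cases y; simp_all

instance (N : ℕ) : Monoid (CntMon N) where
  mul x y := ⟨min (x.val + y.val) N, min_le_right _ _⟩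
  one := ⟨0, Nat.zero_le _⟩
  mul_assoc x y z := by
    apply CntMon.ext'
    change min (min (x.val + y.val) N + z.val) N = min (x.val + min (y.val + z.val) N) N
    omega
  one_mul x := by
    apply CntMon.ext'
    change min (0 + x.val) N = x.val
    have := x.le
    omega
  mul_one x := by
    apply CntMon.ext'
    change min (x.val + 0) N = x.val
    have := x.le
    omega

theorem CntMon.mul_val {N : ℕ} (x y : CntMon N) : (x * y).val = min (x.val + y.val) N := rfl
theorem CntMon.one_val {N : ℕ} : (1 : CntMon N).val = 0 := rfl

instance (N : ℕ) : Finite (CntMon N) :=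
  Finite.of_injective (fun x : CntMon N => (⟨x.val, Nat.lt_succ_of_le x.le⟩ : Fin (N + 1)))
    (fun x y h => CntMon.ext' (by simpa using h))

theorem CntMon.pow_val {N : ℕ} (x : CntMon N) (n : ℕ) : (x ^ n).val = min (n * x.val) N := by
  induction n with
  | zero => simp [CntMon.one_val]
  | succ n ih =>
    rw [pow_succ, CntMon.mul_val, ih, add_mul, one_mul]
    omega

theorem CntMon.aper (N : ℕ) : AperM (CntMon N) := by
  intro m
  refine ⟨N, CntMon.ext' ?_⟩
  rw [CntMon.pow_val, CntMon.pow_val]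
  rcases Nat.eq_zero_or_pos m.val with h | h
  · simp [h]
  · have : N ≤ N * m.val := Nat.le_mul_of_pos_right _ h
    rw [add_mul]
    omega

theorem covered_of_length {Q : Type*} [Monoid Q] [PartialOrder Q] (U : Set Q) {A : Type}
    (α : A → Q) (N : ℕ) (hN : 1 ≤ N) (Y : ℕ → Q) (hY : ∀ k, Y k ∈ U ∨ Y k = 1)
    (h : ∀ w : FreeMonoid A, FreeMonoid.lift α w ≤ Y (min w.length N)) : Covered U α := by
  refine ⟨CntMon N, inferInstance, inferInstance, CntMon.aper N,
    FreeMonoid.lift (fun _ => ⟨1, hN⟩), fun m => Y m.val, fun m => hY _, fun w => ?_⟩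
  have key : ∀ w : FreeMonoid A,
      (FreeMonoid.lift (fun _ : A => (⟨1, hN⟩ : CntMon N)) w).val = min w.length N := by
    intro w
    induction w using FreeMonoid.inductionOn' with
    | one => simp [CntMon.one_val]
    | of_mul x xs ih =>
      rw [map_mul, CntMon.mul_val, ih, FreeMonoid.lift_eval_of, FreeMonoid.length_mul,
        FreeMonoid.length_of]
      simp only
      omega
  change _ ≤ Y (FreeMonoid.lift (fun _ : A => (⟨1, hN⟩ : CntMon N)) w).val
  rw [key]
  exact h w

/-! ### The Rees-type extension -/

/-- Underlying type of the Rees-type extension. -/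
inductive ReesExt (M N : Type) (γ : M → N) : Type
  | low : M → ReesExt M N γ
  | tri : M → N → M → ReesExt M N γ

namespace ReesExt
variable {M N : Type} [Monoid M] [Monoid N] {γ : M → N}

/-- Multiplication. -/
def mul' : ReesExt M N γ → ReesExt M N γ → ReesExt M N γ
  | low m, low m' => low (m * m')
  | low m, tri x n y => tri (m * x) n y
  | tri x n y, low m => tri x n (y * m)
  | tri x n y, tri x' n' y' => tri x (n * γ (y * x') * n') y'

instance : Monoid (ReesExt M N γ) where
  mul := mul'
  one := low 1
  mul_assoc a b c := by
    change mul' (mul' a b) c = mul' a (mul' b c)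
    cases a <;> cases b <;> cases c <;> simp [mul', mul_assoc]
  one_mul a := by
    change mul' (low 1) a = a
    cases a <;> simp [mul']
  mul_one a := by
    change mul' a (low 1) = a
    cases a <;> simp [mul']

theorem one_def : (1 : ReesExt M N γ) = low 1 := rfl
theorem low_mul_low (m m' : M) : (low m * low m' : ReesExt M N γ) = low (m * m') := rfl
theorem low_mul_tri (m x y : M) (n : N) :
    (low m * tri x n y : ReesExt M N γ) = tri (m * x) n y := rfl
theorem tri_mul_low (m x y : M) (n : N) :
    (tri x n y * low m : ReesExt M N γ) = tri x n (y * m) := rfl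
theorem tri_mul_tri (x y x' y' : M) (n n' : N) :
    (tri x n y * tri x' n' y' : ReesExt M N γ) = tri x (n * γ (y * x') * n') y' := rfl

instance [Finite M] [Finite N] : Finite (ReesExt M N γ) := by
  refine Finite.of_injective
    (fun z : ReesExt M N γ => (match z with
      | low m => Sum.inl m
      | tri x n y => Sum.inr (x, n, y) : M ⊕ (M × N × M))) ?_
  intro a b h
  cases a <;> cases b <;> simp_all

theorem low_pow (m : M) (n : ℕ) : (low m : ReesExt M N γ) ^ n = low (m ^ n) := by
  induction n with
  | zero => simp [one_def]
  | succ n ih => rw [pow_succ, ih, low_mul_low, pow_succ]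

theorem tri_pow (x y : M) (n : N) (k : ℕ) :
    (tri x n y : ReesExt M N γ) ^ (k + 1) = tri x (n * (γ (y * x) * n) ^ k) y := by
  induction k with
  | zero => simp
  | succ k ih => rw [pow_succ, ih, tri_mul_tri, pow_succ (γ (y * x) * n)]; simp [mul_assoc]

theorem aper (hM : AperM M) (hN : AperM N) : AperM (ReesExt M N γ) := by
  intro z
  cases z with
  | low m =>
    obtain ⟨n, hn⟩ := hM m
    exact ⟨n, by rw [low_pow, low_pow, hn]⟩
  | tri x n y =>
    obtain ⟨k, hk⟩ := hN (γ (y * x) * n)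
    exact ⟨k + 1, by rw [tri_pow, tri_pow, hk]⟩

end ReesExt

section step
set_option linter.unusedSectionVars false
variable {Q : Type*} [Monoid Q] [PartialOrder Q] [MulLeftMono Q] [MulRightMono Q]

open ReesExt in
theorem rees_step {U : Set Q} {A : Type} (α : A → Q) (a : A)
    (M N : Type) [Monoid M] [Monoid N] [Finite M] [Finite N] (hM : AperM M) (hN : AperM N)
    (hU : ∀ x ∈ U, ∀ y ∈ U, x * y ∈ U)
    (hB : FreeMonoid {b : A // b ≠ a} →* M) (βB : M → Q)
    (hβB : ∀ m, βB m ∈ U ∨ βB m = 1)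
    (hb : ∀ w, FreeMonoid.lift (fun b : {b : A // b ≠ a} => α b) w ≤ βB (hB w))
    (g : FreeMonoid M →* N) (βN : N → Q) (hβN : ∀ n, βN n ∈ U)
    (hn : ∀ l : FreeMonoid M, α a * FreeMonoid.lift (fun m => βB m * α a) l ≤ βN (g l)) :
    Covered U α := by
  classical
  let γ : M → N := fun m => g (FreeMonoid.of m)
  let H : FreeMonoid A →* ReesExt M N γ := FreeMonoid.lift
    (fun b => if h : b = a then tri 1 1 1 else low (hB (FreeMonoid.of ⟨b, h⟩)))
  let β : ReesExt M N γ → Q := fun z => match z with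
    | low m => βB m
    | tri x n y => βB x * βN n * βB y
  refine ⟨ReesExt M N γ, inferInstance, inferInstance, aper hM hN, H, β, ?_, ?_⟩
  · intro z
    cases z with
    | low m => exact hβB m
    | tri x n y =>
      left
      change βB x * βN n * βB y ∈ U
      have h1 : βB x * βN n ∈ U := by
        rcases hβB x with h | h
        · exact hU _ h _ (hβN n)
        · rw [h, one_mul]; exact hβN n
      rcases hβB y with h | h
      · exact hU _ h1 _ h
      · rw [h, mul_one]; exact h1
  · let αB : {b : A // b ≠ a} → Q := fun b => α b
    have key : ∀ w : FreeMonoid A,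
        (∃ u, H w = low (hB u) ∧ FreeMonoid.lift α w = FreeMonoid.lift αB u) ∨
        (∃ u0 l u1, H w = tri (hB u0) (g l) (hB u1) ∧
          FreeMonoid.lift α w ≤ FreeMonoid.lift αB u0 *
            (α a * FreeMonoid.lift (fun m => βB m * α a) l) * FreeMonoid.lift αB u1) := by
      intro w
      induction w using FreeMonoid.inductionOn' with
      | one => left; exact ⟨1, by simp [one_def], by simp⟩
      | of_mul c w ih =>
        rw [map_mul, map_mul, FreeMonoid.lift_eval_of α]
        by_cases hc : c = a
        · have hH : H (FreeMonoid.of c) = tri 1 1 1 := by simp [H, hc]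
          rw [hH, hc]
          right
          rcases ih with ⟨u, h1, h2⟩ | ⟨u0, l, u1, h1, h2⟩
          · refine ⟨1, 1, u, ?_, ?_⟩
            · rw [h1, tri_mul_low]; simp
            · rw [h2]; simp
          · refine ⟨1, FreeMonoid.of (hB u0) * l, u1, ?_, ?_⟩
            · rw [h1, tri_mul_tri]; simp [γ]
            · refine (mul_le_mul_right h2 _).trans ?_
              have := hb u0
              simp only [map_mul, map_one, one_mul, FreeMonoid.lift_eval_of, mul_assoc]
              gcongr
        · have hH : H (FreeMonoid.of c) = low (hB (FreeMonoid.of ⟨c, hc⟩)) := by simp [H, hc]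
          rw [hH]
          rcases ih with ⟨u, h1, h2⟩ | ⟨u0, l, u1, h1, h2⟩
          · left
            refine ⟨FreeMonoid.of ⟨c, hc⟩ * u, ?_, ?_⟩
            · rw [h1, low_mul_low, map_mul]
            · rw [h2]; simp [αB]
          · right
            refine ⟨FreeMonoid.of ⟨c, hc⟩ * u0, l, u1, ?_, ?_⟩
            · rw [h1, low_mul_tri, map_mul]
            · refine (mul_le_mul_right h2 _).trans ?_
              simp only [map_mul, FreeMonoid.lift_eval_of, mul_assoc, αB]
              exact le_rfl
    intro w
    rcases key w with ⟨u, h1, h2⟩ | ⟨u0, l, u1, h1, h2⟩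
    · rw [h1, h2]; exact hb u
    · rw [h1]
      refine h2.trans ?_
      change _ ≤ βB (hB u0) * βN (g l) * βB (hB u1)
      exact mul_le_mul' (mul_le_mul' (hb u0) (hn l)) (hb u1)

theorem GoodSet.left {U : Set Q} (hU : GoodSet U) {a : Q} (ha : a ∈ U) :
    GoodSet {x | x = a ∨ ∃ y ∈ U, x = y * a} := by
  have sub : ∀ x, (x = a ∨ ∃ y ∈ U, x = y * a) → x ∈ U := by
    rintro x (rfl | ⟨y, hy, rfl⟩)
    · exact ha
    · exact hU.mul _ hy _ ha
  have ml : ∀ x ∈ U, ∀ z, (z = a ∨ ∃ y ∈ U, z = y * a) → ∃ y ∈ U, x * z = y * a := by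
    rintro x hx z (rfl | ⟨y, hy, rfl⟩)
    · exact ⟨x, hx, rfl⟩
    · exact ⟨x * y, hU.mul _ hx _ hy, by rw [mul_assoc]⟩
  refine ⟨fun x hx y hy => Or.inr (ml x (sub x hx) y hy), fun x hx => ?_⟩
  obtain ⟨y, hy, N, h⟩ := hU.bnd x (sub x hx)
  refine ⟨y * x, Or.inr (ml y hy x hx), N + 1, fun n hn => ?_⟩
  obtain ⟨k, rfl⟩ := Nat.exists_eq_add_of_le' hn
  rw [← add_assoc, pow_succ]
  exact mul_le_mul_left (h _ (by omega)) x

theorem GoodSet.right {U : Set Q} (hU : GoodSet U) {a : Q} (ha : a ∈ U) :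
    GoodSet {x | x = a ∨ ∃ y ∈ U, x = a * y} := by
  have sub : ∀ x, (x = a ∨ ∃ y ∈ U, x = a * y) → x ∈ U := by
    rintro x (rfl | ⟨y, hy, rfl⟩)
    · exact ha
    · exact hU.mul _ ha _ hy
  have ml : ∀ x ∈ U, ∀ z, (z = a ∨ ∃ y ∈ U, z = a * y) → ∃ y ∈ U, z * x = a * y := by
    rintro x hx z (rfl | ⟨y, hy, rfl⟩)
    · exact ⟨x, hx, rfl⟩
    · exact ⟨y * x, hU.mul _ hy _ hx, by rw [mul_assoc]⟩
  refine ⟨fun x hx y hy => Or.inr (ml y (sub y hy) x hx), fun x hx => ?_⟩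
  obtain ⟨y, hy, N, h⟩ := hU.bnd x (sub x hx)
  refine ⟨x * y, Or.inr (ml y hy x hx), N + 1, fun n hn => ?_⟩
  obtain ⟨k, rfl⟩ := Nat.exists_eq_add_of_le' hn
  rw [← add_assoc, pow_succ']
  exact mul_le_mul_right (h _ (by omega)) x

/-- All letters have the same value. -/
theorem covered_const {U : Set Q} (hU : GoodSet U) {A : Type} (α : A → Q) (x : Q) (hx : x ∈ U)
    (h : ∀ b, α b = x) : Covered U α := by
  obtain ⟨y, hy, N, hN⟩ := hU.bnd x hx
  refine covered_of_length U α (N + 1) (by omega) (fun k => if k = N + 1 then y else x ^ k) ?_ ?_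
  · intro k
    split_ifs
    · exact Or.inl hy
    · induction k with
      | zero => right; simp
      | succ k ih =>
        left
        have : x ^ k ∈ U ∨ x ^ k = 1 := by
          by_cases hk : k = N + 1
          · clear ih
            have : ∀ j, x ^ (j + 1) ∈ U := by
              intro j
              induction j with
              | zero => simpa using hx
              | succ j ih => rw [pow_succ]; exact hU.mul _ ih _ hx
            left; rw [hk]; exact this _
          · exact ih hk
        rw [pow_succ]
        rcases this with h | h
        · exact hU.mul _ h _ hx
        · rw [h, one_mul]; exact hx
  · intro w
    have : FreeMonoid.lift α w = x ^ w.length := by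
      induction w using FreeMonoid.inductionOn' with
      | one => simp
      | of_mul c w ih =>
        rw [map_mul, ih, FreeMonoid.lift_eval_of, h, FreeMonoid.length_mul, FreeMonoid.length_of,
          pow_add, pow_one]
    rw [this]
    split_ifs with hk
    · exact hN _ (by omega)
    · rw [min_eq_left (by omega)]

/-- The group case. -/
theorem covered_group {U : Set Q} (hfin : U.Finite) (hU : GoodSet U) {A : Type} (α : A → Q)
    (a : A) (hα : ∀ b, α b ∈ U)
    (hR : ∀ b, ∀ x ∈ U, ∃ y ∈ U, x = y * α b)
    (hL : ∀ b, ∀ x ∈ U, ∃ y ∈ U, x = α b * y) : Covered U α := by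
  -- the identity
  obtain ⟨e, heU, he⟩ := hR a (α a) (hα a)
  have el : ∀ x ∈ U, e * x = x := by
    intro x hx
    obtain ⟨y, hy, rfl⟩ := hL a x hx
    rw [← mul_assoc, ← he]
  obtain ⟨e', heU', he'⟩ := hL a (α a) (hα a)
  have er' : ∀ x ∈ U, x * e' = x := by
    intro x hx
    obtain ⟨y, hy, rfl⟩ := hR a x hx
    rw [mul_assoc, ← he']
  have hee : e' = e := by rw [← el e' heU', er' e heU]
  rw [hee] at er'
  let G : Set Q := {x | x ∈ U ∧ ∀ z ∈ U, ∃ y ∈ U, z = y * x}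
  have hG : ∀ x ∈ G, ∀ y ∈ G, x * y ∈ G := by
    rintro x ⟨hx, hx'⟩ y ⟨hy, hy'⟩
    refine ⟨hU.mul _ hx _ hy, fun z hz => ?_⟩
    obtain ⟨u, hu, rfl⟩ := hy' z hz
    obtain ⟨v, hv, rfl⟩ := hx' u hu
    exact ⟨v, hv, by rw [mul_assoc]⟩
  have hpow : ∀ x ∈ G, ∀ n, x ^ (n + 1) ∈ G := by
    intro x hx n
    induction n with
    | zero => simpa using hx
    | succ n ih => rw [pow_succ]; exact hG _ ih _ hx
  have hord : ∀ x ∈ G, ∃ d, 1 ≤ d ∧ x ^ d = e := by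
    intro x hx
    have : ¬ Function.Injective (fun n : ℕ => (⟨x ^ (n + 1), (hpow x hx n).1⟩ : U)) := by
      have := hfin.to_subtype
      exact not_injective_infinite_finite _
    simp only [Function.Injective, not_forall] at this
    obtain ⟨i, j, hij, hne⟩ := this
    have hij : x ^ (i + 1) = x ^ (j + 1) := by simpa using hij
    have main : ∀ i j : ℕ, i < j → x ^ (i + 1) = x ^ (j + 1) → ∃ d, 1 ≤ d ∧ x ^ d = e := by
      intro i j hlt hij
      refine ⟨j - i, by omega, ?_⟩
      obtain ⟨y, hy, hey⟩ := (hpow x hx i).2 e heU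
      have hxd : x ^ (j - i) ∈ U := by
        have := (hpow x hx (j - i - 1)).1
        rwa [show j - i - 1 + 1 = j - i by omega] at this
      calc x ^ (j - i) = e * x ^ (j - i) := (el _ hxd).symm
        _ = y * x ^ (j + 1) := by
          rw [hey, mul_assoc, ← pow_add]; congr 2; omega
        _ = e := by rw [← hij, ← hey]
    rcases lt_or_gt_of_ne hne with h | h
    · exact main i j h hij
    · exact main j i h hij.symm
  have hbound : ∀ x ∈ G, ∃ y ∈ U, e ≤ y ∧ x ≤ y := by
    intro x hx
    obtain ⟨d, hd, hxd⟩ := hord x hx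
    obtain ⟨y, hy, N, hN⟩ := hU.bnd x hx.1
    have hp : ∀ n, x ^ (d * (n + 1)) = e := by
      intro n
      rw [pow_mul, hxd]
      induction n with
      | zero => simp
      | succ n ih => rw [pow_succ, ih, el e heU]
    have hle : N ≤ d * (N + 1) := by nlinarith
    refine ⟨y, hy, ?_, ?_⟩
    · rw [← hp N]; exact hN _ hle
    · have := hN (d * (N + 1) + 1) (by omega)
      rwa [pow_succ, hp, el x hx.1] at this
  have hGfin : G.Finite := hfin.subset (fun x hx => hx.1)
  have hall : ∀ s : Finset Q, (∀ x ∈ s, x ∈ G) → ∃ z ∈ U, e ≤ z ∧ ∀ x ∈ s, x ≤ z := by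
    classical
    intro s
    induction s using Finset.induction_on with
    | empty => intro _; exact ⟨e, heU, le_rfl, by simp⟩
    | insert x s hxs ih =>
      intro h
      obtain ⟨z, hz, hez, hsz⟩ := ih (fun y hy => h y (Finset.mem_insert_of_mem hy))
      obtain ⟨y, hy, hey, hxy⟩ := hbound x (h x (Finset.mem_insert_self _ _))
      refine ⟨y * z, hU.mul _ hy _ hz, ?_, ?_⟩
      · calc e = e * e := (el e heU).symm
          _ ≤ y * z := mul_le_mul' hey hez
      · intro u hu
        rcases Finset.mem_insert.1 hu with rfl | hu'
        · calc u = u * e := (er' u (h u (Finset.mem_insert_self _ _)).1).symm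
            _ ≤ y * z := mul_le_mul' hxy hez
        · calc u = e * u := (el u (h u hu).1).symm
            _ ≤ y * z := mul_le_mul' hey (hsz u hu')
  obtain ⟨z, hz, hez, hGz⟩ := hall hGfin.toFinset (fun x hx => hGfin.mem_toFinset.1 hx)
  have hwG : ∀ w : FreeMonoid A, w = 1 ∨ FreeMonoid.lift α w ∈ G := by
    intro w
    induction w using FreeMonoid.inductionOn' with
    | one => exact Or.inl rfl
    | of_mul c w ih =>
      right
      have hc : α c ∈ G := ⟨hα c, hR c⟩
      rw [map_mul, FreeMonoid.lift_eval_of]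
      rcases ih with rfl | ih
      · simpa using hc
      · exact hG _ hc _ ih
  refine covered_of_length U α 1 le_rfl (fun k => if k = 0 then 1 else z) ?_ ?_
  · intro k
    split_ifs
    · exact Or.inr rfl
    · exact Or.inl hz
  · intro w
    by_cases hw : w = 1
    · subst hw; simp
    · have : w.length ≠ 0 := by
        intro h; exact hw (FreeMonoid.length_eq_zero.1 h)
      rw [if_neg (by omega)]
      exact hGz _ (hGfin.mem_toFinset.2 ((hwG w).resolve_left hw))

theorem covered_all : ∀ (n : ℕ) (U : Set Q), U.Finite → U.ncard = n → GoodSet U →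
    ∀ (k : ℕ) (A : Type) [Finite A], Nat.card A = k → ∀ α : A → Q, (∀ a, α a ∈ U) →
      Covered U α := by
  intro n
  induction n using Nat.strong_induction_on with
  | _ n ihn =>
  intro U hfin hcard hU k
  induction k using Nat.strong_induction_on with
  | _ k ihk =>
  intro A _ hA α hα
  have hB : ∀ a : A, Covered U (fun b : {b : A // b ≠ a} => α b) := by
    intro a
    refine ihk _ ?_ _ rfl _ (fun b => hα b)
    rw [← hA]
    exact Finite.card_subtype_lt (x := a) (by simp)
  have hsmall : ∀ V : Set Q, V ⊆ U → V ≠ U → GoodSet V → ∀ (D : Type) [Finite D] (δ : D → Q),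
      (∀ d, δ d ∈ V) → Covered V δ := by
    intro V hVU hne hV D _ δ hδ
    refine ihn _ ?_ V (hfin.subset hVU) rfl hV _ D rfl δ hδ
    rw [← hcard]
    exact Set.ncard_lt_ncard (lt_of_le_of_ne hVU hne) hfin
  by_cases hl : ∃ a, ∃ x ∈ U, ¬ (x = α a ∨ ∃ y ∈ U, x = y * α a)
  · obtain ⟨a, x, hx, hxa⟩ := hl
    obtain ⟨M, _, _, hM, h, βB, hβ, hb⟩ := hB a
    have hsub : {x | x = α a ∨ ∃ y ∈ U, x = y * α a} ⊆ U := by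
      rintro z (rfl | ⟨y, hy, rfl⟩)
      · exact hα a
      · exact hU.mul _ hy _ (hα a)
    obtain ⟨N, _, _, hN, g, βN, hβN, hn⟩ := hsmall _ hsub
      (fun h => hxa (by rw [← h] at hx; exact hx)) (hU.left (hα a)) M (fun m => βB m * α a) (by
        intro m
        rcases hβ m with h | h
        · exact Or.inr ⟨_, h, rfl⟩
        · exact Or.inl (by rw [h, one_mul]))
    refine rees_step α a M N hM hN hU.mul h βB hβ hb g (fun n => α a * βN n) ?_ ?_
    · intro n
      rcases hβN n with h | h
      · exact hU.mul _ (hα a) _ (hsub h)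
      · simp only [h, mul_one]; exact hα a
    · intro l
      exact mul_le_mul_right (hn l) _
  by_cases hr : ∃ a, ∃ x ∈ U, ¬ (x = α a ∨ ∃ y ∈ U, x = α a * y)
  · obtain ⟨a, x, hx, hxa⟩ := hr
    obtain ⟨M, _, _, hM, h, βB, hβ, hb⟩ := hB a
    have hsub : {x | x = α a ∨ ∃ y ∈ U, x = α a * y} ⊆ U := by
      rintro z (rfl | ⟨y, hy, rfl⟩)
      · exact hα a
      · exact hU.mul _ (hα a) _ hy
    obtain ⟨N, _, _, hN, g, βN, hβN, hn⟩ := hsmall _ hsub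
      (fun h => hxa (by rw [← h] at hx; exact hx)) (hU.right (hα a)) M (fun m => α a * βB m) (by
        intro m
        rcases hβ m with h | h
        · exact Or.inr ⟨_, h, rfl⟩
        · exact Or.inl (by rw [h, mul_one]))
    refine rees_step α a M N hM hN hU.mul h βB hβ hb g (fun n => βN n * α a) ?_ ?_
    · intro n
      rcases hβN n with h | h
      · exact hU.mul _ (hsub h) _ (hα a)
      · simp only [h, one_mul]; exact hα a
    · intro l
      have : α a * FreeMonoid.lift (fun m => βB m * α a) l
          = FreeMonoid.lift (fun m => α a * βB m) l * α a := by
        induction l using FreeMonoid.inductionOn' with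
        | one => simp
        | of_mul c w ih =>
          rw [map_mul, map_mul, FreeMonoid.lift_eval_of, FreeMonoid.lift_eval_of, mul_assoc,
            mul_assoc, mul_assoc, ih]
      rw [this]
      exact mul_le_mul_left (hn l) _
  push Not at hl hr
  rcases isEmpty_or_nonempty A with hemp | ⟨⟨a⟩⟩
  · refine covered_of_length U α 1 le_rfl (fun _ => 1) (fun _ => Or.inr rfl) (fun w => ?_)
    induction w using FreeMonoid.inductionOn' with
    | one => simp
    | of_mul c w ih => exact hemp.elim c
  by_cases h1 : ∃ a, ¬ ∃ y ∈ U, α a = y * α a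
  · obtain ⟨a, ha⟩ := h1
    refine covered_const hU α (α a) (hα a) (fun b => ?_)
    by_contra hb
    obtain ⟨y, hy, hy'⟩ := (hl a (α b) (hα b)).resolve_left hb
    obtain ⟨z, hz, hz'⟩ := (hl b (α a) (hα a)).resolve_left (fun h => hb h.symm)
    exact ha ⟨z * y, hU.mul _ hz _ hy, by rw [mul_assoc, ← hy', ← hz']⟩
  by_cases h2 : ∃ a, ¬ ∃ y ∈ U, α a = α a * y
  · obtain ⟨a, ha⟩ := h2
    refine covered_const hU α (α a) (hα a) (fun b => ?_)
    by_contra hb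
    obtain ⟨y, hy, hy'⟩ := (hr a (α b) (hα b)).resolve_left hb
    obtain ⟨z, hz, hz'⟩ := (hr b (α a) (hα a)).resolve_left (fun h => hb h.symm)
    exact ha ⟨y * z, hU.mul _ hy _ hz, by rw [← mul_assoc, ← hy', ← hz']⟩
  push Not at h1 h2
  refine covered_group hfin hU α a hα ?_ ?_
  · intro b x hx
    rcases hl b x hx with rfl | h
    · exact h1 b
    · exact h
  · intro b x hx
    rcases hr b x hx with rfl | h
    · exact h2 b
    · exact h

end step

/-! ### κ-terms -/

theorem coe_spow {T : Type} [Semigroup T] (s : T) (n : ℕ) :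
    ((spow s n : T) : WithOne T) = (s : WithOne T) ^ (n + 1) := by
  induction n with
  | zero => simp [spow]
  | succ n ih =>
    have : spow s (n + 1) = spow s n * s := by
      simp only [spow]; rw [Function.iterate_succ_apply']
    rw [this, WithOne.coe_mul, ih, ← pow_succ]

theorem kEval_omm_finite {A T : Type} [Semigroup T] [Finite T] (f : A → T) (u : KTerm A) (s : T)
    (h : KEval f u s) : ∃ j, KEval f (KTerm.ommPow u) (spow s j) := by
  have hni : ¬ Function.Injective (fun n : ℕ => spow s n) := not_injective_infinite_finite _
  simp only [Function.Injective, not_forall] at hni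
  obtain ⟨i, j, hij, hne⟩ := hni
  have h2 : ∃ i d : ℕ, 1 ≤ d ∧ (s : WithOne T) ^ (i + 1) = (s : WithOne T) ^ (i + 1 + d) := by
    have hij' : (s : WithOne T) ^ (i + 1) = (s : WithOne T) ^ (j + 1) := by
      rw [← coe_spow, ← coe_spow, hij]
    rcases lt_or_gt_of_ne hne with h | h
    · exact ⟨i, j - i, by omega, by rw [hij']; congr 1; omega⟩
    · exact ⟨j, i - j, by omega, by rw [← hij']; congr 1; omega⟩
  obtain ⟨i, d, hd, hid⟩ := h2
  have hper : ∀ m, i + 1 ≤ m → ∀ c, (s : WithOne T) ^ (m + c * d) = (s : WithOne T) ^ m := by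
    intro m hm c
    induction c with
    | zero => simp
    | succ c ih =>
      obtain ⟨r, rfl⟩ := Nat.exists_eq_add_of_le hm
      have : i + 1 + r + (c + 1) * d = (i + 1 + d) + (r + c * d) := by ring
      rw [this, pow_add, ← hid, ← pow_add, ← ih]
      congr 1; ring
  -- `k = (i+1) d` gives the idempotent
  obtain ⟨k, hk⟩ : ∃ k, k + 1 = (i + 1) * d :=
    ⟨(i + 1) * d - 1, by have : 1 ≤ (i + 1) * d := Nat.mul_pos (by omega) hd
                         omega⟩
  have hki : i + 1 ≤ k + 1 := by rw [hk]; exact Nat.le_mul_of_pos_right _ hd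
  have hp : ∀ m, i + 1 ≤ m → (s : WithOne T) ^ (m + (k + 1)) = (s : WithOne T) ^ m := by
    intro m hm; rw [hk]; exact hper m hm _
  have hee : (s : WithOne T) ^ (k + 1 + (k + 1)) = (s : WithOne T) ^ (k + 1) := hp _ hki
  refine ⟨2 * k + 1 + k, KEval.ommPow (e := spow s k) h ?_ ⟨_, rfl⟩ ⟨_, rfl⟩ ?_ ?_ ?_⟩
  · apply WithOne.coe_inj.1
    rw [WithOne.coe_mul, coe_spow, ← pow_add, hee]
  · apply WithOne.coe_inj.1
    rw [WithOne.coe_mul, coe_spow, coe_spow, ← pow_succ,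
      show 2 * k + 1 + k + 1 + 1 = k + 1 + (k + 1) + (k + 1) by ring, hp _ (by omega), hee]
  · apply WithOne.coe_inj.1
    rw [WithOne.coe_mul, coe_spow, coe_spow, ← pow_succ',
      show 2 * k + 1 + k + 1 + 1 = k + 1 + (k + 1) + (k + 1) by ring, hp _ (by omega), hee]
  · apply WithOne.coe_inj.1
    rw [WithOne.coe_mul, coe_spow, coe_spow, ← pow_add, hp _ (by omega)]

theorem pow_stab {T : Type} [Semigroup T] {t : T} {m : ℕ} (hm : spow t m = spow t (m + 1))
    (n : ℕ) (hn : m + 1 ≤ n) : (t : WithOne T) ^ n = (t : WithOne T) ^ (m + 1) := by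
  have h : (t : WithOne T) ^ (m + 1) = (t : WithOne T) ^ (m + 1 + 1) := by
    rw [← coe_spow, ← coe_spow, hm]
  induction n, hn using Nat.le_induction with
  | base => rfl
  | succ n hn ih => rw [pow_succ, ih, ← pow_succ, ← h]

theorem kEval_omm_aper {A T : Type} [Semigroup T] (f : A → T) (u : KTerm A) (t : T) (k m : ℕ)
    (hm : spow t m = spow t (m + 1)) (h : KEval f u (spow t k)) :
    KEval f (KTerm.ommPow u) (spow t m) := by
  have hpow : spow (spow t k) m = spow t m := by
    apply WithOne.coe_inj.1
    rw [coe_spow, coe_spow, coe_spow, ← pow_mul]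
    exact pow_stab hm _ (Nat.le_mul_of_pos_left _ (by omega))
  refine KEval.ommPow (e := spow t m) h ?_ ⟨m, hpow⟩ ⟨m, hpow⟩ ?_ ?_ ?_
  all_goals
    apply WithOne.coe_inj.1
    rw [WithOne.coe_mul]
    simp only [coe_spow, ← pow_add]
    exact pow_stab hm _ (by omega)

/-- `P` has a family of κ-terms that agree over aperiodic semigroups. -/
def KPoint {S A : Type} [Semigroup S] (f₀ : A → S) (P : Set S) : Prop :=
  ∃ w : P → KTerm A, (∀ p : P, KEval f₀ (w p) (p : S)) ∧
    (∀ (T : Type) [Semigroup T] [Finite T], IsAperiodic T →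
      ∀ f : A → T, ∃ t : T, ∀ p : P, KEval f (w p) t)

theorem KPoint.mono {S A : Type} [Semigroup S] {f₀ : A → S} {P P' : Set S} (h : KPoint f₀ P')
    (hs : P ⊆ P') : KPoint f₀ P := by
  obtain ⟨w, h1, h2⟩ := h
  refine ⟨fun p => w ⟨p, hs p.2⟩, fun p => h1 ⟨p, hs p.2⟩, fun T _ _ hT f => ?_⟩
  obtain ⟨t, ht⟩ := h2 T hT f
  exact ⟨t, fun p => ht _⟩

theorem KPoint.mul {S A : Type} [Semigroup S] {f₀ : A → S} {P P' : Set S} (h : KPoint f₀ P)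
    (h' : KPoint f₀ P') : KPoint f₀ {r | ∃ p ∈ P, ∃ q ∈ P', p * q = r} := by
  obtain ⟨w, h1, h2⟩ := h
  obtain ⟨w', h1', h2'⟩ := h'
  have hch : ∀ r : {r | ∃ p ∈ P, ∃ q ∈ P', p * q = r}, ∃ (p : P) (q : P'), (p * q : S) = r := by
    rintro ⟨r, p, hp, q, hq, rfl⟩
    exact ⟨⟨p, hp⟩, ⟨q, hq⟩, rfl⟩
  choose a b hab using hch
  refine ⟨fun r => KTerm.mul (w (a r)) (w' (b r)), fun r => ?_, fun T _ _ hT f => ?_⟩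
  · rw [← hab r]; exact KEval.mul (h1 _) (h1' _)
  · obtain ⟨t, ht⟩ := h2 T hT f
    obtain ⟨t', ht'⟩ := h2' T hT f
    exact ⟨t * t', fun r => KEval.mul (ht _) (ht' _)⟩

/-- Terms for products of lists. -/
theorem list_term {S A : Type} [Semigroup S] {f₀ : A → S} {P : Set S} (w : P → KTerm A)
    (h1 : ∀ p : P, KEval f₀ (w p) (p : S)) (L : List P) : ∀ x : P,
    ∃ (v : KTerm A) (s : S),
      (s : WithOne S) = ((x :: L).map (fun p : P => ((p : S) : WithOne S))).prod ∧ KEval f₀ v s ∧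
      ∀ (T : Type) [Semigroup T] (f : A → T) (t : T), (∀ p : P, KEval f (w p) t) →
        KEval f v (spow t L.length) := by
  induction L with
  | nil => intro x; exact ⟨w x, x, by simp, h1 x, fun T _ f t ht => by simpa [spow] using ht x⟩
  | cons y L ih =>
    intro x
    obtain ⟨v, s, hs, hv, hT⟩ := ih y
    refine ⟨KTerm.mul (w x) v, x * s, ?_, KEval.mul (h1 x) hv, fun T _ f t ht => ?_⟩
    · rw [WithOne.coe_mul, hs]; simp
    · have : spow t (y :: L).length = t * spow t L.length := by
        apply WithOne.coe_inj.1
        rw [WithOne.coe_mul, coe_spow, coe_spow, ← pow_succ', List.length_cons]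
      rw [this]
      exact KEval.mul (ht x) (hT T f t ht)

theorem list_term' {S A : Type} [Semigroup S] {f₀ : A → S} {P : Set S} (w : P → KTerm A)
    (h1 : ∀ p : P, KEval f₀ (w p) (p : S)) (L : List P) (hL : L ≠ []) :
    ∃ (v : KTerm A) (s : S),
      (s : WithOne S) = (L.map (fun p : P => ((p : S) : WithOne S))).prod ∧ KEval f₀ v s ∧
      ∀ (T : Type) [Semigroup T] (f : A → T) (t : T), (∀ p : P, KEval f (w p) t) →
        KEval f v (spow t (L.length - 1)) := by
  cases L with
  | nil => exact absurd rfl hL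
  | cons x L => simpa using list_term w h1 L x

theorem pump_term {S A : Type} [Semigroup S] [Finite S] {f₀ : A → S} {P : Set S} (w : P → KTerm A)
    (h1 : ∀ p : P, KEval f₀ (w p) (p : S)) (L : List P) (hL : Nat.card S + 1 ≤ L.length) (r : S)
    (hr : (r : WithOne S) = (L.map (fun p : P => ((p : S) : WithOne S))).prod) :
    ∃ v : KTerm A, KEval f₀ v r ∧
      ∀ (T : Type) [Semigroup T] (f : A → T) (t : T), (∀ p : P, KEval f (w p) t) →
        ∀ m, spow t m = spow t (m + 1) → KEval f v (spow t m) := by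
  have hpre : ∀ i : Fin (Nat.card S + 1), ∃ s : S,
      (s : WithOne S) = ((L.take (i + 1)).map (fun p : P => ((p : S) : WithOne S))).prod := by
    intro i
    obtain ⟨v, s, hs, _⟩ := list_term' w h1 (L.take (i + 1)) (by
      intro h
      have := congrArg List.length h
      simp only [List.length_take, List.length_nil] at this
      omega)
    exact ⟨s, hs⟩
  choose F hF using hpre
  have hni : ¬ Function.Injective F := by
    intro hinj
    have := Nat.card_le_card_of_injective F hinj
    simp at this
  have h2 : ∃ i j : Fin (Nat.card S + 1), i < j ∧ F i = F j := by
    simp only [Function.Injective, not_forall] at hni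
    obtain ⟨i, j, hij, hne⟩ := hni
    rcases lt_or_gt_of_ne hne with h | h
    · exact ⟨i, j, h, hij⟩
    · exact ⟨j, i, h, hij.symm⟩
  obtain ⟨i, j, hlt, hij⟩ := h2
  have hlt' : (i : ℕ) < j := hlt
  have hj := j.2
  obtain ⟨v1, s1, hs1, hv1, hT1⟩ := list_term' w h1 (L.take (i + 1)) (by
      intro h
      have := congrArg List.length h
      simp only [List.length_take, List.length_nil] at this
      omega)
  obtain ⟨v2, s2, hs2, hv2, hT2⟩ := list_term' w h1 ((L.take (j + 1)).drop (i + 1)) (by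
      intro h
      have := congrArg List.length h
      simp only [List.length_take, List.length_nil, List.length_drop] at this
      omega)
  have hs12 : s1 * s2 = s1 := by
    apply WithOne.coe_inj.1
    have e1 : (s1 : WithOne S) = F j := by rw [← hij, hs1, hF]
    rw [WithOne.coe_mul]
    conv_rhs => rw [e1, hF]
    rw [hs1, hs2, ← List.prod_append, ← List.map_append]
    have : L.take (i + 1) = (L.take (j + 1)).take (i + 1) := by
      rw [List.take_take, min_eq_left (by omega)]
    rw [this, List.take_append_drop]
  have hpows : ∀ c, s1 * spow s2 c = s1 := by
    intro c
    induction c with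
    | zero => exact hs12
    | succ c ih =>
      have : spow s2 (c + 1) = spow s2 c * s2 := by
        simp only [spow]; rw [Function.iterate_succ_apply']
      rw [this, ← mul_assoc, ih, hs12]
  obtain ⟨c, hc⟩ := kEval_omm_finite f₀ v2 s2 hv2
  have hfirst : KEval f₀ (KTerm.mul v1 (KTerm.ommPow v2)) s1 := by
    have := KEval.mul hv1 hc
    rwa [hpows] at this
  have hfirstT : ∀ (T : Type) [Semigroup T] (f : A → T) (t : T), (∀ p : P, KEval f (w p) t) →
        ∀ m, spow t m = spow t (m + 1) →
          KEval f (KTerm.mul v1 (KTerm.ommPow v2)) (spow t m) := by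
    intro T _ f t ht m hm
    have h3 := KEval.mul (hT1 T f t ht) (kEval_omm_aper f v2 t _ m hm (hT2 T f t ht))
    convert h3 using 1
    apply WithOne.coe_inj.1
    rw [WithOne.coe_mul]
    simp only [coe_spow, ← pow_add]
    exact (pow_stab hm _ (by omega)).symm
  have hs1j : (s1 : WithOne S)
      = ((L.take (j + 1)).map (fun p : P => ((p : S) : WithOne S))).prod := by
    rw [← hF, ← hij, hF, hs1]
  by_cases hnil : L.drop (j + 1) = []
  · refine ⟨_, ?_, hfirstT⟩
    have : r = s1 := by
      apply WithOne.coe_inj.1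
      rw [hr, hs1j]
      conv_lhs => rw [← List.take_append_drop (j + 1) L, hnil, List.append_nil]
    rw [this]; exact hfirst
  · obtain ⟨v3, s3, hs3, hv3, hT3⟩ := list_term' w h1 (L.drop (j + 1)) hnil
    refine ⟨KTerm.mul (KTerm.mul v1 (KTerm.ommPow v2)) v3, ?_, ?_⟩
    · have : r = s1 * s3 := by
        apply WithOne.coe_inj.1
        rw [hr, WithOne.coe_mul, hs1j, hs3, ← List.prod_append, ← List.map_append,
          List.take_append_drop]
      rw [this]; exact KEval.mul hfirst hv3
    · intro T _ f t ht m hm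
      have h3 := KEval.mul (hfirstT T f t ht m hm) (hT3 T f t ht)
      convert h3 using 1
      apply WithOne.coe_inj.1
      rw [WithOne.coe_mul]
      simp only [coe_spow, ← pow_add]
      exact (pow_stab hm _ (by omega)).symm

theorem KPoint.omega {S A : Type} [Semigroup S] [Finite S] {f₀ : A → S} {P : Set S}
    (h : KPoint f₀ P) : KPoint f₀ {r : S | ∃ L : List P, Nat.card S + 1 ≤ L.length ∧
      (r : WithOne S) = (L.map (fun p : P => ((p : S) : WithOne S))).prod} := by
  obtain ⟨w, h1, h2⟩ := h
  have hch : ∀ r : {r : S | ∃ L : List P, Nat.card S + 1 ≤ L.length ∧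
      (r : WithOne S) = (L.map (fun p : P => ((p : S) : WithOne S))).prod},
      ∃ v : KTerm A, KEval f₀ v r ∧
      ∀ (T : Type) [Semigroup T] (f : A → T) (t : T), (∀ p : P, KEval f (w p) t) →
        ∀ m, spow t m = spow t (m + 1) → KEval f v (spow t m) := by
    rintro ⟨r, L, hL, hr⟩
    exact pump_term w h1 L hL r hr
  choose v hv hvT using hch
  refine ⟨v, hv, fun T _ _ hT f => ?_⟩
  obtain ⟨t, ht⟩ := h2 T hT f
  obtain ⟨m, hm⟩ := hT t
  exact ⟨spow t m, fun r => hvT r T f t ht m hm⟩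

open scoped Pointwise in
theorem goodSet_kPoint {S A : Type} [Semigroup S] [Finite S] (f₀ : A → S) :
    GoodSet {X : Set (WithOne S) | ∃ P : Set S, KPoint f₀ P ∧ X = (fun s : S => (s : WithOne S)) '' P} := by
  constructor
  · rintro _ ⟨P, hP, rfl⟩ _ ⟨P', hP', rfl⟩
    refine ⟨_, hP.mul hP', ?_⟩
    ext x
    constructor
    · rintro ⟨_, ⟨p, hp, rfl⟩, _, ⟨q, hq, rfl⟩, rfl⟩
      exact ⟨p * q, ⟨p, hp, q, hq, rfl⟩, WithOne.coe_mul _ _⟩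
    · rintro ⟨_, ⟨p, hp, q, hq, rfl⟩, rfl⟩
      exact ⟨_, ⟨p, hp, rfl⟩, _, ⟨q, hq, rfl⟩, (WithOne.coe_mul _ _).symm⟩
  · rintro _ ⟨P, hP, rfl⟩
    refine ⟨_, ⟨_, hP.omega, rfl⟩, Nat.card S + 1, fun n hn x hx => ?_⟩
    have key : ∀ n, ∀ x ∈ ((fun s : S => (s : WithOne S)) '' P) ^ n, ∃ L : List P, L.length = n ∧
        x = (L.map (fun p : P => ((p : S) : WithOne S))).prod := by
      intro n
      induction n with
      | zero => intro x hx; exact ⟨[], rfl, by simpa using hx⟩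
      | succ n ih =>
        intro x hx
        rw [pow_succ'] at hx
        obtain ⟨_, ⟨p, hp, rfl⟩, y, hy, rfl⟩ := hx
        obtain ⟨L, hL, rfl⟩ := ih y hy
        exact ⟨⟨p, hp⟩ :: L, by simp [hL], by simp⟩
    obtain ⟨L, hL, hxL⟩ := key n x hx
    have hne : L ≠ [] := by rintro rfl; simp at hL; omega
    have hs : ∃ s : S, (s : WithOne S) = x := by
      obtain ⟨w, h1, _⟩ := hP
      obtain ⟨_, s, hs, _⟩ := list_term' w h1 L hne
      exact ⟨s, by rw [hs, hxL]⟩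
    obtain ⟨s, rfl⟩ := hs
    exact ⟨s, ⟨L, by omega, hxL⟩, rfl⟩

open scoped Pointwise in
theorem kPoint_of_pointlike {S : Type} [Semigroup S] [Finite S]
    (P : Set S) (hP : IsAperiodicPointlike P) (A : Type) [Finite A]
    (φ : FreeSemigroup A →ₙ* S) (hφ : Function.Surjective φ) :
    KPoint (fun a => φ (FreeSemigroup.of a)) P := by
  classical
  have hAne : Nonempty A := by
    by_contra hA
    rw [not_nonempty_iff] at hA
    have hFe : IsEmpty (FreeSemigroup A) := ⟨fun x => hA.elim x.1⟩
    have hSe : IsEmpty S := ⟨fun s => by obtain ⟨x, _⟩ := hφ s; exact hFe.elim x⟩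
    let _ : Semigroup Empty := { mul := fun a _ => a, mul_assoc := fun a => a.elim }
    obtain ⟨t, _⟩ := hP Empty (fun t => t.elim) ⊤ (fun s => hSe.elim s)
    exact t.elim
  obtain ⟨a₀⟩ := hAne
  rcases P.eq_empty_or_nonempty with rfl | ⟨p₀, hp₀⟩
  · exact ⟨fun p => p.2.elim, fun p => p.2.elim, fun T _ _ _ f => ⟨f a₀, fun p => p.2.elim⟩⟩
  let f₀ : A → S := fun a => φ (FreeSemigroup.of a)
  let α : A → Set (WithOne S) := fun a => {(f₀ a : WithOne S)}
  let U : Set (Set (WithOne S)) :=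
    {X | ∃ P : Set S, KPoint f₀ P ∧ X = (fun s : S => (s : WithOne S)) '' P}
  have hα : ∀ a, α a ∈ U := by
    intro a
    refine ⟨{f₀ a}, ⟨fun _ => KTerm.letter a, ?_, ?_⟩, by simp [α]⟩
    · rintro ⟨p, rfl⟩; exact KEval.letter a
    · intro T _ _ _ f; exact ⟨f a, fun _ => KEval.letter a⟩
  have hfinS : Finite (WithOne S) := inferInstanceAs (Finite (Option S))
  obtain ⟨M, _, _, hM, h, β, hβ, hc⟩ :=
    covered_all _ U (Set.toFinite U) rfl (goodSet_kPoint f₀) _ A rfl α hα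
  -- the words
  let ι : FreeSemigroup A →ₙ* FreeMonoid A := FreeSemigroup.lift FreeMonoid.of
  have hι : ∀ u : FreeSemigroup A, FreeMonoid.lift α (ι u) = {(φ u : WithOne S)} := by
    intro u
    induction u using FreeSemigroup.recOnMul with
    | ih1 a => simp [ι, α, f₀]
    | ih2 a y iha ihy => rw [map_mul, map_mul, map_mul, iha, ihy, WithOne.coe_mul, Set.singleton_mul_singleton]
  have hMa : IsAperiodic M := by
    intro m
    obtain ⟨n, hn⟩ := hM m
    have hsp : ∀ k, spow m k = m ^ (k + 1) := by
      intro k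
      induction k with
      | zero => simp [spow]
      | succ k ih =>
        have : spow m (k + 1) = spow m k * m := by
          simp only [spow]; rw [Function.iterate_succ_apply']
        rw [this, ih, ← pow_succ]
    refine ⟨n, ?_⟩
    rw [hsp, hsp, pow_succ, hn, ← pow_succ]
  let R : Subsemigroup (S × M) :=
    { carrier := {z | ∃ u, φ u = z.1 ∧ h (ι u) = z.2}
      mul_mem' := by
        rintro ⟨_, _⟩ ⟨_, _⟩ ⟨u, rfl, rfl⟩ ⟨v, rfl, rfl⟩
        exact ⟨u * v, by simp, by simp⟩ }
  obtain ⟨t, ht⟩ := hP M hMa R (fun s => by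
    obtain ⟨u, rfl⟩ := hφ s
    exact ⟨h (ι u), u, rfl, rfl⟩)
  have hmem : ∀ p ∈ P, ((p : S) : WithOne S) ∈ β t := by
    intro p hp
    obtain ⟨u, h1, h2⟩ := ht p hp
    have h1 : φ u = p := h1
    have h2 : h (ι u) = t := h2
    have := hc (ι u)
    rw [hι, h1, h2] at this
    exact this rfl
  rcases hβ t with ⟨P', hP', he⟩ | h1
  · refine hP'.mono (fun p hp => ?_)
    have := hmem p hp
    rw [he] at this
    obtain ⟨q, hq, hqp⟩ := this
    have := WithOne.coe_inj.1 hqp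
    rwa [← this]
  · have := hmem p₀ hp₀
    rw [h1] at this
    exact absurd this (by simp)

/-- The pseudovariety `A` of finite aperiodic semigroups is κ-reducible for
pointlike sets. -/
theorem aperiodic_kappa_reducible_for_pointlikes
    {S : Type} [Semigroup S] [Finite S]
    (P : Set S) (hP : IsAperiodicPointlike P)
    (A : Type) [Finite A]
    (φ : FreeSemigroup A →ₙ* S) (hφ : Function.Surjective φ) :
    ∃ w : P → KTerm A,
      (∀ p : P, KEval (fun a => φ (FreeSemigroup.of a)) (w p) (p : S)) ∧
      (∀ (T : Type) [Semigroup T] [Finite T], IsAperiodic T →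
        ∀ f : A → T, ∃ t : T, ∀ p : P, KEval f (w p) t) := by
  exact kPoint_of_pointlike P hP A φ hφ
end

section
/- The pseudovariety DA is ω-reducible for pointlike sets: let S be a finite semigroup and P a DA-pointlike subset of S. Then for every finite alphabet A and every surjective homomorphism φ: A⁺ → S from the free semigroup on A, there exists a family (w_p)_{p∈P} of ω-terms over A such that, for each p ∈ P, w_p evaluates to p in S under the letter assignment given by φ restricted to A, and for every finite semigroup T in DA and every map from A to T, all the terms w_p evaluate to one and the same element of T. -/
/-- A finite semigroup lies in `DA` if each of its regular elements is
idempotent, where `s` is regular if `s = s * x * s` for some `x`. -/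
def InDA (T : Type) [Semigroup T] : Prop :=
  ∀ t : T, (∃ x : T, t = t * x * t) → IsIdempotentElem t

/-- ω-terms over the alphabet `A`: letters, binary multiplication and the
unary ω-power. -/
inductive OTerm (A : Type) : Type
  | letter : A → OTerm A
  | mul : OTerm A → OTerm A → OTerm A
  | omPow : OTerm A → OTerm A

/-- The evaluation relation for ω-terms in a semigroup `T`, given an assignment
`f` of letters.  The ω-power of an element `s` is the (unique, in a finite
semigroup) idempotent power of `s`. -/
inductive OEval {A T : Type} [Semigroup T] (f : A → T) : OTerm A → T → Prop
  | letter (a : A) : OEval f (OTerm.letter a) (f a)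
  | mul {u v : OTerm A} {s t : T} :
      OEval f u s → OEval f v t → OEval f (OTerm.mul u v) (s * t)
  | omPow {u : OTerm A} {s e : T} :
      OEval f u s →
      IsIdempotentElem e → (∃ n : ℕ, spow s n = e) →
      OEval f (OTerm.omPow u) e

/-- `P` is pointlike for the pseudovariety `DA`: for every finite semigroup `T`
in `DA` and every subsemigroup `R` of `S × T` projecting onto `S`, some `t ∈ T`
is related to every element of `P`. -/
def IsDAPointlike {S : Type} [Semigroup S] (P : Set S) : Prop :=
  ∀ (T : Type) [Semigroup T] [Finite T], InDA T →
    ∀ R : Subsemigroup (S × T),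
      (∀ s : S, ∃ t : T, (s, t) ∈ R) →
      ∃ t : T, ∀ p ∈ P, (p, t) ∈ R

/-! ### Monoid ω-terms -/

open scoped Pointwise

namespace DAProof

theorem exists_idem {T : Type} [Monoid T] [Finite T] (x : T) :
    ∃ n : ℕ, x ^ (n + 1) * x ^ (n + 1) = x ^ (n + 1) := by
  obtain ⟨i, j, hij, h⟩ := Finite.exists_ne_map_eq_of_infinite (fun n : ℕ => x ^ n)
  wlog hlt : i < j generalizing i j
  · exact this j i hij.symm h.symm (by omega)
  obtain ⟨d, rfl⟩ : ∃ d, j = i + (d + 1) := ⟨j - i - 1, by omega⟩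
  have key : ∀ k, x ^ (i + k * (d + 1)) = x ^ i := by
    intro k
    induction k with
    | zero => simp
    | succ k ih =>
      have : i + (k + 1) * (d + 1) = (i + k * (d + 1)) + (d + 1) := by ring
      rw [this, pow_add, ih, ← pow_add, ← h]
  refine ⟨(i + 1) * (d + 1) - 1, ?_⟩
  have e : (i + 1) * (d + 1) - 1 + 1 = i + (i * d + d + 1) := by
    have : (i + 1) * (d + 1) = i + (i * d + d + 1) := by ring
    omega
  rw [e, ← pow_add]
  have : i + (i * d + d + 1) + (i + (i * d + d + 1))
      = (i + (i + 1) * (d + 1)) + (i * d + d + 1) := by ring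
  rw [this, pow_add, key, ← pow_add]

noncomputable def omN {T : Type} [Monoid T] [Finite T] (x : T) : ℕ := (exists_idem x).choose

noncomputable def om {T : Type} [Monoid T] [Finite T] (x : T) : T := x ^ (omN x + 1)

theorem om_idem {T : Type} [Monoid T] [Finite T] (x : T) : om x * om x = om x :=
  (exists_idem x).choose_spec

def DAm (T : Type) [Monoid T] : Prop := ∀ t : T, (∃ x : T, t = t * x * t) → t * t = t

section DA
variable {T : Type} [Monoid T]

theorem pow_idem {e : T} (he : e * e = e) (n : ℕ) : e ^ (n + 1) = e := by
  induction n with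
  | zero => simp
  | succ n ih => rw [pow_succ, ih, he]

/-- If `e y` is `R`-equivalent to `e` then `e y e = e`. -/
theorem DAm.loc_of_right (h : DAm T) {e y z : T} (he : e * e = e) (hz : e * y * z = e) :
    e * y * e = e := by
  have h1 : (e * y) * (e * y) = e * y := by
    apply h
    refine ⟨z * e, ?_⟩
    calc e * y = e * e * y := by rw [he]
      _ = (e * y * z) * e * y := by rw [hz]
      _ = _ := by simp only [mul_assoc]; rw [← mul_assoc e e, he]
  calc e * y * e = e * y * (e * y * z) := by rw [hz]
    _ = (e * y) * (e * y) * z := by simp only [mul_assoc]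
    _ = e := by rw [h1, hz]

theorem DAm.loc_mul (h : DAm T) {e y z : T} (hy : e * y * e = e)
    (hz : e * z * e = e) : e * (y * z) * e = e := by
  have h1 : (z * e) * (z * e) = z * e := by
    rw [mul_assoc, ← mul_assoc e, hz]
  have h2 : (z * e * y) * (z * e * y) = z * e * y := by
    apply h
    refine ⟨e, ?_⟩
    calc z * e * y = z * (e * z * e) * y := by rw [hz]
      _ = z * ((e * y * e) * z * e) * y := by rw [hy]
      _ = _ := by simp only [mul_assoc]
  calc e * (y * z) * e = (e * z * e) * (y * z) * (e * y * e) := by rw [hy, hz]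
    _ = e * ((z * e * y) * (z * e * y)) * e := by simp only [mul_assoc]
    _ = (e * z * e) * y * e := by rw [h2]; simp only [mul_assoc]
    _ = e := by rw [hz, hy]

theorem DAm.loc_factor (h : DAm T) {e p a q : T} (he : e * e = e) (hp : e = p * a * q) :
    e * a * e = e := by
  have h1 : (a * q * e) * (a * q * e) = a * q * e := by
    apply h
    refine ⟨p, ?_⟩
    calc a * q * e = a * q * (e * e * e) := by rw [he, he]
      _ = a * q * (e * (p * a * q) * e) := by rw [← hp]
      _ = a * q * (e * (p * a * q * e)) := by simp only [mul_assoc]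
      _ = a * q * e * (p * a * q * e) := by simp only [mul_assoc]
      _ = _ := by simp only [mul_assoc]
  refine h.loc_of_right (z := q * e) he ?_
  calc e * a * (q * e) = (p * a * q) * (a * q * e) := by rw [← hp]; simp only [mul_assoc]
    _ = (p * a * q) * e * (a * q * e) := by rw [← hp, he]
    _ = p * ((a * q * e) * (a * q * e)) := by simp only [mul_assoc]
    _ = (p * a * q) * e := by rw [h1]; simp only [mul_assoc]
    _ = e := by rw [← hp, he]

/-- The local submonoid. -/
def locSub (h : DAm T) (e : T) (he : e * e = e) : Submonoid T where
  carrier := {y | e * y * e = e}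
  mul_mem' hy hz := h.loc_mul hy hz
  one_mem' := by simp [he]

variable [Finite T]

theorem DAm.om_mul_self (h : DAm T) (t : T) : om t * t = om t := by
  have h1 : om t * t * om t = om t := by
    apply h.loc_factor (p := 1) (q := t ^ omN t) (om_idem t)
    rw [one_mul, ← pow_succ']; rfl
  have hc : t * om t = om t * t := by unfold om; rw [← pow_succ, ← pow_succ']
  rwa [mul_assoc, hc, ← mul_assoc, om_idem] at h1

theorem DAm.om_mul_pow (h : DAm T) (t : T) (n : ℕ) : om t * t ^ n = om t := by
  induction n with
  | zero => simp
  | succ n ih => rw [pow_succ, ← mul_assoc, ih, h.om_mul_self]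

theorem DAm.pow_mul_om (h : DAm T) (t : T) (n : ℕ) : t ^ n * om t = om t := by
  have : t ^ n * om t = om t * t ^ n := by
    unfold om; rw [← pow_add, ← pow_add, add_comm]
  rw [this, h.om_mul_pow]

theorem om_pow (t : T) (n : ℕ) : om (t ^ (n + 1)) = om t := by
  obtain ⟨k, hk⟩ : ∃ k, om (t ^ (n+1)) = t ^ (k + 1) := by
    refine ⟨n * (omN (t ^ (n+1)) + 1) + omN (t ^ (n+1)), ?_⟩
    unfold om; rw [← pow_mul]; congr 1; ring
  have e : (t ^ (k+1)) * (t ^ (k+1)) = t ^ (k+1) := by rw [← hk, om_idem]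
  have h2 : (om t) ^ (k+1) = om t := pow_idem (om_idem t) k
  have h3 : (t ^ (k+1)) ^ (omN t + 1) = t ^ (k+1) := pow_idem e _
  rw [hk, ← h3, ← pow_mul, mul_comm, pow_mul]
  exact h2

end DA

/-- ω-terms with a unit. -/
inductive MTerm (A : Type) : Type
  | one : MTerm A
  | letter : A → MTerm A
  | mul : MTerm A → MTerm A → MTerm A
  | omPow : MTerm A → MTerm A

namespace MTerm
variable {A : Type}

noncomputable def eval {T : Type} [Monoid T] [Finite T] (f : A → T) : MTerm A → T
  | one => 1
  | letter a => f a
  | mul u v => eval f u * eval f v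
  | omPow u => om (eval f u)

def content : MTerm A → Set A
  | one => ∅
  | letter a => {a}
  | mul u v => content u ∪ content v
  | omPow u => content u

def red : MTerm A → Option (OTerm A)
  | one => none
  | letter a => some (OTerm.letter a)
  | mul u v => match red u, red v with
    | none, y => y
    | some x, none => some x
    | some x, some y => some (OTerm.mul x y)
  | omPow u => (red u).map OTerm.omPow

instance finiteWithOne {S : Type} [Finite S] : Finite (WithOne S) :=
  inferInstanceAs (Finite (Option S))

theorem coe_spow {T : Type} [Semigroup T] (x : T) (n : ℕ) :
    ((spow x n : T) : WithOne T) = (x : WithOne T) ^ (n + 1) := by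
  induction n with
  | zero => simp [spow]
  | succ n ih =>
    have : spow x (n+1) = spow x n * x := by
      unfold spow; rw [Function.iterate_succ_apply']
    rw [this, WithOne.coe_mul, ih, ← pow_succ]

theorem om_one {T : Type} [Monoid T] [Finite T] : om (1 : T) = 1 := by simp [om]

theorem red_spec {T : Type} [Semigroup T] [Finite T] (f : A → T) (t : MTerm A) :
    (red t = none ∧ eval (fun a => (f a : WithOne T)) t = 1) ∨
    ∃ (t' : OTerm A) (x : T), red t = some t' ∧ eval (fun a => (f a : WithOne T)) t = (x : WithOne T) ∧
      OEval f t' x := by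
  induction t with
  | one => left; exact ⟨rfl, rfl⟩
  | letter a => right; exact ⟨_, _, rfl, rfl, OEval.letter a⟩
  | mul u v hu hv =>
    rcases hu with ⟨h1, h2⟩ | ⟨u', x, h1, h2, h3⟩ <;>
    rcases hv with ⟨k1, k2⟩ | ⟨v', y, k1, k2, k3⟩
    · left; simp [red, eval, h1, h2, k1, k2]
    · right; exact ⟨v', y, by simp [red, h1, k1], by simp [eval, h2, k2], k3⟩
    · right; exact ⟨u', x, by simp [red, h1, k1], by simp [eval, h2, k2], h3⟩
    · right; exact ⟨OTerm.mul u' v', x * y, by simp [red, h1, k1], by simp [eval, h2, k2],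
        OEval.mul h3 k3⟩
  | omPow u hu =>
    rcases hu with ⟨h1, h2⟩ | ⟨u', x, h1, h2, h3⟩
    · left; simp [red, eval, h1, h2, om_one]
    · right
      have e : om (x : WithOne T) = (spow x (omN (x : WithOne T)) : T) := by
        rw [coe_spow]; rfl
      refine ⟨OTerm.omPow u', spow x (omN (x : WithOne T)), by simp [red, h1],
        by rw [eval, h2, e], OEval.omPow h3 ?_ ⟨_, rfl⟩⟩
      apply WithOne.coe_injective
      have := om_idem (x : WithOne T)
      rw [e] at this
      exact this

theorem mem_content_factor {T : Type} [Monoid T] [Finite T] (f : A → T) (t : MTerm A) (a : A)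
    (ha : a ∈ content t) : ∃ p q, eval f t = p * f a * q := by
  induction t with
  | one => exact absurd ha (by simp [content])
  | letter b => obtain rfl : a = b := ha; exact ⟨1, 1, by simp [eval]⟩
  | mul u v hu hv =>
    rcases ha with ha | ha
    · obtain ⟨p, q, h⟩ := hu ha
      exact ⟨p, q * eval f v, by simp [eval, h, mul_assoc]⟩
    · obtain ⟨p, q, h⟩ := hv ha
      exact ⟨eval f u * p, q, by simp [eval, h, mul_assoc]⟩
  | omPow u hu =>
    obtain ⟨p, q, h⟩ := hu ha
    refine ⟨p, q * (eval f u) ^ (omN (eval f u)), ?_⟩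
    simp only [eval]
    rw [← mul_assoc, ← h, ← pow_succ']; rfl

theorem eval_mem {T : Type} [Monoid T] [Finite T] (f : A → T) (M : Submonoid T) (t : MTerm A)
    (h : ∀ a ∈ content t, f a ∈ M) : eval f t ∈ M := by
  induction t with
  | one => exact M.one_mem
  | letter b => exact h b rfl
  | mul u v hu hv =>
    exact M.mul_mem (hu fun a ha => h a (Or.inl ha)) (hv fun a ha => h a (Or.inr ha))
  | omPow u hu => exact M.pow_mem (hu h) _

theorem loc_eval {T : Type} [Monoid T] [Finite T] (hT : DAm T) (f : A → T) (u y : MTerm A)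
    (h : content y ⊆ content u) :
    om (eval f u) * eval f y * om (eval f u) = om (eval f u) := by
  refine eval_mem f (locSub hT (om (eval f u)) (om_idem _)) y fun a ha => ?_
  obtain ⟨p, q, hpq⟩ := mem_content_factor f (omPow u) a (h ha)
  exact hT.loc_factor (om_idem _) hpq

theorem om_mul_om {T : Type} [Monoid T] [Finite T] (hT : DAm T) (f : A → T) (u v y : MTerm A)
    (huv : content u = content v) (h : content y ⊆ content u) :
    om (eval f u) * eval f y * om (eval f v) = om (eval f u) * om (eval f v) := by
  have h1 := loc_eval hT f v (omPow u) (by rw [← huv]; exact subset_rfl)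
  have h2 := loc_eval hT f u (mul y (omPow v)) (by
    intro a ha
    rcases ha with ha | ha
    · exact h ha
    · rw [huv]; exact ha)
  simp only [eval] at h1 h2
  calc om (eval f u) * eval f y * om (eval f v)
      = om (eval f u) * eval f y * (om (eval f v) * om (eval f u) * om (eval f v)) := by rw [h1]
    _ = (om (eval f u) * (eval f y * om (eval f v)) * om (eval f u)) * om (eval f v) := by
        simp only [mul_assoc]
    _ = _ := by rw [h2]

/-- Equality over all finite monoids of DA. -/
def Eqv (u v : MTerm A) : Prop :=
  ∀ (T : Type) [Monoid T] [Finite T], DAm T → ∀ f : A → T, eval f u = eval f v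

def lprod : List (MTerm A) → MTerm A
  | [] => one
  | u :: l => mul u (lprod l)

theorem eval_lprod {T : Type} [Monoid T] [Finite T] (f : A → T) (l : List (MTerm A)) :
    eval f (lprod l) = (l.map (eval f)).prod := by
  induction l with
  | nil => rfl
  | cons u l ih => simp [lprod, eval, ih]

theorem eval_lprod_const {T : Type} [Monoid T] [Finite T] (f : A → T) (l : List (MTerm A)) (t : T)
    (h : ∀ u ∈ l, eval f u = t) : eval f (lprod l) = t ^ l.length := by
  induction l with
  | nil => simp [lprod, eval]
  | cons u l ih =>
    simp only [lprod, eval, List.length_cons]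
    rw [ih fun u hu => h u (by simp [hu]), h u (by simp), pow_succ']

theorem content_lprod (l : List (MTerm A)) (a : A) :
    a ∈ content (lprod l) ↔ ∃ u ∈ l, a ∈ content u := by
  induction l with
  | nil => simp [lprod, content]
  | cons u l ih => simp [lprod, content, ih]

end MTerm

/-- Pigeonhole on prefixes. -/
theorem pigeon_left {N : Type} [Monoid N] [Finite N] (l : List N) (hl : Nat.card N ≤ l.length) :
    ∃ l1 l2 l3, l = l1 ++ l2 ++ l3 ∧ l2 ≠ [] ∧ l1.prod * l2.prod = l1.prod := by
  obtain ⟨i, j, hij, h⟩ : ∃ i j : Fin (l.length + 1), i ≠ j ∧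
      (l.take i).prod = (l.take j).prod := by
    by_contra hcon
    push Not at hcon
    have : Function.Injective (fun i : Fin (l.length + 1) => (l.take i).prod) := by
      intro i j hh
      by_contra hne
      exact hcon i j hne hh
    have := Nat.card_le_card_of_injective _ this
    simp at this
    omega
  wlog hlt : i < j generalizing i j
  · exact this j i hij.symm h.symm (lt_of_le_of_ne (not_lt.mp hlt) hij.symm)
  have hlt' : (i : ℕ) < j := hlt
  have e : l.take j = l.take i ++ (l.take j).drop i := by
    conv_lhs => rw [← List.take_append_drop i (l.take j)]
    rw [List.take_take, min_eq_left hlt'.le]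
  refine ⟨l.take i, (l.take j).drop i, l.drop j, ?_, ?_, ?_⟩
  · rw [← e, List.take_append_drop]
  · intro hn
    have := congrArg List.length hn
    have hj := j.2
    simp at this
    omega
  · rw [← List.prod_append, ← e, h]

theorem pigeon_right {N : Type} [Monoid N] [Finite N] (l : List N) (hl : Nat.card N ≤ l.length) :
    ∃ l1 l2 l3, l = l1 ++ l2 ++ l3 ∧ l2 ≠ [] ∧ l2.prod * l3.prod = l3.prod := by
  have hc : Nat.card Nᵐᵒᵖ = Nat.card N := Nat.card_congr MulOpposite.opEquiv.symm
  have : Finite Nᵐᵒᵖ := Finite.of_equiv N MulOpposite.opEquiv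
  obtain ⟨l1, l2, l3, h1, h2, h3⟩ := pigeon_left (N := Nᵐᵒᵖ) (l.map MulOpposite.op).reverse
    (by rw [hc]; simpa using hl)
  have key : ∀ m : List Nᵐᵒᵖ, m.prod = MulOpposite.op ((m.map MulOpposite.unop).reverse.prod) := by
    intro m
    rw [MulOpposite.op_list_prod, List.map_reverse, List.reverse_reverse]
    simp
  refine ⟨(l3.map MulOpposite.unop).reverse, (l2.map MulOpposite.unop).reverse,
    (l1.map MulOpposite.unop).reverse, ?_, by simpa using h2, ?_⟩
  · have := congrArg (fun m => (m.map MulOpposite.unop).reverse) h1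
    simpa [Function.comp_def] using this
  · rw [key l1, key l2, ← MulOpposite.op_mul] at h3
    exact MulOpposite.op_injective h3

end DAProof

/-! ### The congruences -/

namespace DAProof

section Cong
variable {A : Type}

open Classical in
noncomputable def splitL (a : A) : List A → Option (List A × List A)
  | [] => none
  | b :: w => if b = a then some ([], w) else (splitL a w).map fun p => (b :: p.1, p.2)

noncomputable def splitR (a : A) (w : List A) : Option (List A × List A) :=
  (splitL a w.reverse).map fun p => (p.2.reverse, p.1.reverse)

theorem splitL_none {a : A} {w : List A} (h : a ∉ w) : splitL a w = none := by
  induction w with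
  | nil => rfl
  | cons b w ih =>
    simp only [List.mem_cons, not_or] at h
    simp [splitL, Ne.symm h.1, ih h.2]

theorem splitL_some {a : A} {u v : List A} (h : a ∉ u) : splitL a (u ++ a :: v) = some (u, v) := by
  induction u with
  | nil => simp [splitL]
  | cons b w ih =>
    simp only [List.mem_cons, not_or] at h
    simp [splitL, Ne.symm h.1, ih h.2]

theorem splitR_none {a : A} {w : List A} (h : a ∉ w) : splitR a w = none := by
  simp [splitR, splitL_none (w := w.reverse) (by simpa using h)]

theorem splitR_some {a : A} {u v : List A} (h : a ∉ v) : splitR a (u ++ a :: v) = some (u, v) := by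
  have : (u ++ a :: v).reverse = v.reverse ++ a :: u.reverse := by simp
  rw [splitR, this, splitL_some (by simpa using h)]
  simp

theorem exL {a : A} {w : List A} (h : a ∈ w) : ∃ u v, w = u ++ a :: v ∧ a ∉ u := by
  classical
  induction w with
  | nil => simp at h
  | cons b w ih =>
    by_cases hb : a = b
    · exact ⟨[], w, by simp [hb], by simp⟩
    · obtain ⟨u, v, rfl, h2⟩ := ih (by simpa [hb] using h)
      exact ⟨b :: u, v, by simp, by simp [hb, h2]⟩

theorem exR {a : A} {w : List A} (h : a ∈ w) : ∃ u v, w = u ++ a :: v ∧ a ∉ v := by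
  obtain ⟨u, v, h1, h2⟩ := exL (w := w.reverse) (a := a) (by simpa using h)
  refine ⟨v.reverse, u.reverse, ?_, by simpa using h2⟩
  have := congrArg List.reverse h1
  simpa using this

/-- Types of depth `n`. -/
def Ty (A : Type) : ℕ → Type
  | 0 => Unit
  | n + 1 => A → Option (Ty A n × Ty A n) × Option (Ty A n × Ty A n)

theorem finite_Ty [Finite A] (n : ℕ) : Finite (Ty A n) := by
  induction n with
  | zero => exact inferInstanceAs (Finite Unit)
  | succ n ih =>
    exact inferInstanceAs (Finite (A → Option (Ty A n × Ty A n) × Option (Ty A n × Ty A n)))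

noncomputable def ty : (n : ℕ) → List A → Ty A n
  | 0, _ => ()
  | n + 1, w => fun a =>
    ((splitL a w).map fun p => (ty n p.1, ty n p.2), (splitR a w).map fun p => (ty n p.1, ty n p.2))

def E (n : ℕ) (u v : List A) : Prop := ty n u = ty n v

theorem E.refl (n : ℕ) (u : List A) : E n u u := rfl
theorem E.symm {n : ℕ} {u v : List A} (h : E n u v) : E n v u := Eq.symm h
theorem E.trans {n : ℕ} {u v w : List A} (h : E n u v) (h' : E n v w) : E n u w := Eq.trans h h'

def LRel (n : ℕ) (a : A) (u v : List A) : Prop :=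
  (a ∉ u ∧ a ∉ v) ∨ ∃ u0 u1 v0 v1, u = u0 ++ a :: u1 ∧ v = v0 ++ a :: v1 ∧ a ∉ u0 ∧ a ∉ v0 ∧
    E n u0 v0 ∧ E n u1 v1

def RRel (n : ℕ) (a : A) (u v : List A) : Prop :=
  (a ∉ u ∧ a ∉ v) ∨ ∃ u0 u1 v0 v1, u = u0 ++ a :: u1 ∧ v = v0 ++ a :: v1 ∧ a ∉ u1 ∧ a ∉ v1 ∧
    E n u0 v0 ∧ E n u1 v1

theorem E_succ {n : ℕ} {u v : List A} : E (n+1) u v ↔ ∀ a, LRel n a u v ∧ RRel n a u v := by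
  constructor
  · intro h a
    have h' := congrFun h a
    simp only [ty, Prod.mk.injEq] at h'
    obtain ⟨h1, h2⟩ := h'
    constructor
    · by_cases hu : a ∈ u <;> by_cases hv : a ∈ v
      · obtain ⟨u0, u1, rfl, hu0⟩ := exL hu
        obtain ⟨v0, v1, rfl, hv0⟩ := exL hv
        rw [splitL_some hu0, splitL_some hv0] at h1
        simp only [Option.map_some, Option.some.injEq, Prod.mk.injEq] at h1
        exact Or.inr ⟨u0, u1, v0, v1, rfl, rfl, hu0, hv0, h1⟩
      · obtain ⟨u0, u1, rfl, hu0⟩ := exL hu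
        rw [splitL_some hu0, splitL_none hv] at h1
        simp at h1
      · obtain ⟨v0, v1, rfl, hv0⟩ := exL hv
        rw [splitL_some hv0, splitL_none hu] at h1
        simp at h1
      · exact Or.inl ⟨hu, hv⟩
    · by_cases hu : a ∈ u <;> by_cases hv : a ∈ v
      · obtain ⟨u0, u1, rfl, hu0⟩ := exR hu
        obtain ⟨v0, v1, rfl, hv0⟩ := exR hv
        rw [splitR_some hu0, splitR_some hv0] at h2
        simp only [Option.map_some, Option.some.injEq, Prod.mk.injEq] at h2
        exact Or.inr ⟨u0, u1, v0, v1, rfl, rfl, hu0, hv0, h2⟩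
      · obtain ⟨u0, u1, rfl, hu0⟩ := exR hu
        rw [splitR_some hu0, splitR_none hv] at h2
        simp at h2
      · obtain ⟨v0, v1, rfl, hv0⟩ := exR hv
        rw [splitR_some hv0, splitR_none hu] at h2
        simp at h2
      · exact Or.inl ⟨hu, hv⟩
  · intro h
    funext a
    obtain ⟨h1, h2⟩ := h a
    simp only [ty, Prod.mk.injEq]
    constructor
    · rcases h1 with ⟨hu, hv⟩ | ⟨u0, u1, v0, v1, rfl, rfl, hu, hv, e0, e1⟩
      · rw [splitL_none hu, splitL_none hv]
      · rw [splitL_some hu, splitL_some hv]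
        simp only [Option.map_some, Option.some.injEq, Prod.mk.injEq]
        exact ⟨e0, e1⟩
    · rcases h2 with ⟨hu, hv⟩ | ⟨u0, u1, v0, v1, rfl, rfl, hu, hv, e0, e1⟩
      · rw [splitR_none hu, splitR_none hv]
      · rw [splitR_some hu, splitR_some hv]
        simp only [Option.map_some, Option.some.injEq, Prod.mk.injEq]
        exact ⟨e0, e1⟩

theorem E.mem {n : ℕ} {u v : List A} (h : E (n+1) u v) (a : A) : a ∈ u ↔ a ∈ v := by
  rcases (E_succ.mp h a).1 with ⟨hu, hv⟩ | ⟨u0, u1, v0, v1, rfl, rfl, _⟩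
  · simp [hu, hv]
  · simp

theorem append_cons_inj_left {a : A} {u0 u1 w0 w1 : List A} (h : u0 ++ a :: u1 = w0 ++ a :: w1)
    (hu : a ∉ u0) (hw : a ∉ w0) : u0 = w0 ∧ u1 = w1 := by
  have := congrArg (splitL a) h
  rw [splitL_some hu, splitL_some hw] at this
  simpa using this

theorem append_cons_inj_right {a : A} {u0 u1 w0 w1 : List A} (h : u0 ++ a :: u1 = w0 ++ a :: w1)
    (hu : a ∉ u1) (hw : a ∉ w1) : u0 = w0 ∧ u1 = w1 := by
  have := congrArg (splitR a) h
  rw [splitR_some hu, splitR_some hw] at this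
  simpa using this

theorem E.left {n : ℕ} {a : A} {w0 w1 v : List A} (h : E (n+1) v (w0 ++ a :: w1)) (hw : a ∉ w0) :
    ∃ v0 v1, v = v0 ++ a :: v1 ∧ a ∉ v0 ∧ E n v0 w0 ∧ E n v1 w1 := by
  rcases (E_succ.mp h a).1 with ⟨_, hv⟩ | ⟨u0, u1, v0, v1, rfl, e, h1, h2, h3, h4⟩
  · simp at hv
  · obtain ⟨rfl, rfl⟩ := append_cons_inj_left e hw h2
    exact ⟨u0, u1, rfl, h1, h3, h4⟩

theorem E.right {n : ℕ} {a : A} {w0 w1 v : List A} (h : E (n+1) v (w0 ++ a :: w1)) (hw : a ∉ w1) :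
    ∃ v0 v1, v = v0 ++ a :: v1 ∧ a ∉ v1 ∧ E n v0 w0 ∧ E n v1 w1 := by
  rcases (E_succ.mp h a).2 with ⟨_, hv⟩ | ⟨u0, u1, v0, v1, rfl, e, h1, h2, h3, h4⟩
  · simp at hv
  · obtain ⟨rfl, rfl⟩ := append_cons_inj_right e hw h2
    exact ⟨u0, u1, rfl, h1, h3, h4⟩

theorem E.pred {n : ℕ} : ∀ {u v : List A}, E (n+1) u v → E n u v := by
  induction n with
  | zero => intro u v _; rfl
  | succ n ih =>
    intro u v h
    rw [E_succ] at h ⊢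
    intro a
    refine ⟨(h a).1.imp id ?_, (h a).2.imp id ?_⟩
    · rintro ⟨u0, u1, v0, v1, e1, e2, e3, e4, e5, e6⟩
      exact ⟨u0, u1, v0, v1, e1, e2, e3, e4, ih e5, ih e6⟩
    · rintro ⟨u0, u1, v0, v1, e1, e2, e3, e4, e5, e6⟩
      exact ⟨u0, u1, v0, v1, e1, e2, e3, e4, ih e5, ih e6⟩

theorem E.mono {m n : ℕ} (hmn : m ≤ n) {u v : List A} (h : E n u v) : E m u v := by
  induction hmn with
  | refl => exact h
  | step _ ih => exact ih h.pred

theorem E.reverse {n : ℕ} : ∀ {u v : List A}, E n u v → E n u.reverse v.reverse := by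
  induction n with
  | zero => intro u v _; rfl
  | succ n ih =>
    intro u v h
    rw [E_succ] at h ⊢
    intro a
    refine ⟨(h a).2.imp (by simp) ?_, (h a).1.imp (by simp) ?_⟩
    · rintro ⟨u0, u1, v0, v1, rfl, rfl, e3, e4, e5, e6⟩
      exact ⟨u1.reverse, u0.reverse, v1.reverse, v0.reverse, by simp, by simp, by simpa, by simpa,
        ih e6, ih e5⟩
    · rintro ⟨u0, u1, v0, v1, rfl, rfl, e3, e4, e5, e6⟩
      exact ⟨u1.reverse, u0.reverse, v1.reverse, v0.reverse, by simp, by simp, by simpa, by simpa,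
        ih e6, ih e5⟩

theorem E.append_left {n : ℕ} : ∀ {u v : List A} (x : List A), E n u v → E n (x ++ u) (x ++ v) := by
  induction n with
  | zero => intro u v _ _; rfl
  | succ n ih =>
    intro u v x h
    have hp := h.pred
    rw [E_succ] at h ⊢
    intro a
    constructor
    · by_cases hx : a ∈ x
      · obtain ⟨x0, x1, rfl, h0⟩ := exL hx
        exact Or.inr ⟨x0, x1 ++ u, x0, x1 ++ v, by simp, by simp, h0, h0, E.refl _ _, ih x1 hp⟩
      · refine (h a).1.imp (by simp [hx]) ?_
        rintro ⟨u0, u1, v0, v1, rfl, rfl, e3, e4, e5, e6⟩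
        exact ⟨x ++ u0, u1, x ++ v0, v1, by simp, by simp, by simp [hx, e3], by simp [hx, e4],
          ih x e5, e6⟩
    · rcases (h a).2 with ⟨hu, hv⟩ | ⟨u0, u1, v0, v1, rfl, rfl, e3, e4, e5, e6⟩
      · by_cases hx : a ∈ x
        · obtain ⟨x0, x1, rfl, h0⟩ := exR hx
          exact Or.inr ⟨x0, x1 ++ u, x0, x1 ++ v, by simp, by simp, by simp [h0, hu],
            by simp [h0, hv], E.refl _ _, ih x1 hp⟩
        · exact Or.inl (by simp [hx, hu, hv])
      · exact Or.inr ⟨x ++ u0, u1, x ++ v0, v1, by simp, by simp, e3, e4, ih x e5, e6⟩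

theorem E.append_right {n : ℕ} {u v : List A} (x : List A) (h : E n u v) :
    E n (u ++ x) (v ++ x) := by
  have := (h.reverse.append_left x.reverse).reverse
  simpa using this

theorem E.append {n : ℕ} {u v x y : List A} (h : E n u v) (h' : E n x y) :
    E n (u ++ x) (v ++ y) := (h.append_right x).trans (h'.append_left v)

def rep (w : List A) : ℕ → List A
  | 0 => []
  | n + 1 => w ++ rep w n

theorem rep_succ' (w : List A) (n : ℕ) : rep w (n+1) = rep w n ++ w := by
  induction n with
  | zero => simp [rep]
  | succ n ih =>
    calc rep w (n+1+1) = w ++ rep w (n+1) := rfl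
      _ = w ++ (rep w n ++ w) := by rw [ih]
      _ = rep w (n+1) ++ w := by simp [rep]

theorem mem_rep {w : List A} {n : ℕ} {a : A} (h : a ∈ rep w n) : a ∈ w := by
  induction n with
  | zero => simp [rep] at h
  | succ n ih => simp only [rep, List.mem_append] at h; exact h.elim id ih

theorem rep_add (w : List A) (m n : ℕ) : rep w (m + n) = rep w m ++ rep w n := by
  induction m with
  | zero => simp [rep]
  | succ m ih => rw [Nat.succ_add, rep, ih, rep, List.append_assoc]

theorem E_rep (w : List A) (n : ℕ) : ∀ (r r' y z : List A), (∀ a ∈ r, a ∈ w) → (∀ a ∈ r', a ∈ w) →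
    (∀ a ∈ y, a ∈ w) → (∀ a ∈ z, a ∈ w) →
    E n (r ++ rep w n ++ y ++ rep w n ++ r') (r ++ rep w n ++ z ++ rep w n ++ r') := by
  induction n with
  | zero => intros; rfl
  | succ n ih =>
    intro r r' y z hr hr' hy hz
    rw [E_succ]
    intro a
    by_cases ha : a ∈ w
    · constructor
      · obtain ⟨s0, s1, hs, h0⟩ := exL (w := r ++ w) (a := a) (by simp [ha])
        have key : ∀ y, r ++ rep w (n+1) ++ y ++ rep w (n+1) ++ r' =
            s0 ++ a :: (s1 ++ rep w n ++ y ++ rep w n ++ (w ++ r')) := by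
          intro y
          have : r ++ rep w (n+1) ++ y ++ rep w (n+1) ++ r' =
            (r ++ w) ++ rep w n ++ y ++ (rep w n ++ w) ++ r' := by
            rw [← rep_succ']; simp [rep]
          rw [this, hs]; simp
        refine Or.inr ⟨s0, _, s0, _, key y, key z, h0, h0, E.refl _ _, ih _ _ _ _ ?_ ?_ hy hz⟩
        · intro b hb
          have : b ∈ r ++ w := by rw [hs]; simp [hb]
          exact (List.mem_append.mp this).elim (hr b) id
        · intro b hb
          exact (List.mem_append.mp hb).elim id (hr' b)
      · obtain ⟨s0, s1, hs, h0⟩ := exR (w := w ++ r') (a := a) (by simp [ha])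
        have key : ∀ y, r ++ rep w (n+1) ++ y ++ rep w (n+1) ++ r' =
            ((r ++ w) ++ rep w n ++ y ++ rep w n ++ s0) ++ a :: s1 := by
          intro y
          have : r ++ rep w (n+1) ++ y ++ rep w (n+1) ++ r' =
            (r ++ w) ++ rep w n ++ y ++ rep w n ++ (w ++ r') := by
            rw [← List.append_assoc _ w r', List.append_assoc _ (rep w n) w, ← rep_succ']
            simp [rep]
          rw [this, hs]; simp
        refine Or.inr ⟨_, s1, _, s1, key y, key z, h0, h0, ih _ _ _ _ ?_ ?_ hy hz, E.refl _ _⟩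
        · intro b hb
          exact (List.mem_append.mp hb).elim (hr b) id
        · intro b hb
          have : b ∈ w ++ r' := by rw [hs]; simp [hb]
          exact (List.mem_append.mp this).elim id (hr' b)
    · have hn : ∀ y, (∀ a ∈ y, a ∈ w) → a ∉ r ++ rep w (n+1) ++ y ++ rep w (n+1) ++ r' := by
        intro y hy hmem
        simp only [List.mem_append] at hmem
        rcases hmem with (((h | h) | h) | h) | h
        · exact ha (hr a h)
        · exact ha (mem_rep h)
        · exact ha (hy a h)
        · exact ha (mem_rep h)
        · exact ha (hr' a h)
      exact ⟨Or.inl ⟨hn y hy, hn z hz⟩, Or.inl ⟨hn y hy, hn z hz⟩⟩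

theorem E_regular {n : ℕ} {u x : List A} (h : E n u (u ++ x ++ u)) : E n (u ++ u) u := by
  have h1 : ∀ k, E n u (rep (u ++ x) k ++ u) := by
    intro k
    induction k with
    | zero => exact E.refl _ _
    | succ k ih =>
      have := ih.append_left (u ++ x)
      rw [← List.append_assoc] at this
      exact h.trans this
  have h2 := E_rep (u ++ x) n [] u u [] (by simp) (by simp +contextual) (by simp +contextual)
    (by simp)
  simp only [List.nil_append, List.append_nil] at h2
  have h3 : E n (u ++ u) (rep (u ++ x) n ++ u ++ rep (u ++ x) n ++ u) := by
    have := (h1 n).append (h1 n)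
    simpa using this
  have h4 := h1 (n + n)
  rw [rep_add] at h4
  exact (h3.trans h2).trans h4.symm

/-- The congruence on the free monoid. -/
def con (A : Type) (n : ℕ) : Con (FreeMonoid A) where
  r u v := E n u.toList v.toList
  iseqv := ⟨fun _ => E.refl _ _, E.symm, E.trans⟩
  mul' h h' := by
    simp only [FreeMonoid.toList_mul]
    exact E.append h h'

theorem finite_con [Finite A] (n : ℕ) : Finite (con A n).Quotient := by
  have := finite_Ty (A := A) n
  let g : (con A n).Quotient → Ty A n :=
    Quotient.lift (fun w : FreeMonoid A => ty n w.toList) (fun _ _ h => h)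
  refine Finite.of_injective g ?_
  intro x y
  induction x using Quotient.inductionOn
  induction y using Quotient.inductionOn
  intro h
  exact Quotient.sound h

theorem con_DA (n : ℕ) : InDA (con A n).Quotient := by
  rintro t ⟨x, hx⟩
  induction t using Con.induction_on with | _ u
  induction x using Con.induction_on with | _ x
  rw [← Con.coe_mul, ← Con.coe_mul, Con.eq] at hx
  unfold IsIdempotentElem
  rw [← Con.coe_mul, Con.eq]
  exact E_regular hx

theorem peelL {w : List A} (h : w ≠ []) :
    ∃ w0 a w1, w = w0 ++ a :: w1 ∧ a ∉ w0 ∧ ∀ b ∈ w, b ∈ w0 ∨ b = a := by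
  classical
  induction w using List.reverseRecOn with
  | nil => exact absurd rfl h
  | append_singleton w c ih =>
    by_cases hc : c ∈ w
    · obtain ⟨w0, a, w1, rfl, h1, h2⟩ := ih (List.ne_nil_of_mem hc)
      refine ⟨w0, a, w1 ++ [c], by simp, h1, ?_⟩
      intro b hb
      rcases List.mem_append.mp hb with hb | hb
      · exact h2 b hb
      · rw [List.mem_singleton.mp hb]; exact h2 c hc
    · refine ⟨w, c, [], rfl, hc, ?_⟩
      intro b hb
      simpa using hb

theorem peelR {w : List A} (h : w ≠ []) :
    ∃ w0 a w1, w = w0 ++ a :: w1 ∧ a ∉ w1 ∧ ∀ b ∈ w, b ∈ w1 ∨ b = a := by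
  obtain ⟨w0, a, w1, e, h1, h2⟩ := peelL (w := w.reverse) (by simpa using h)
  refine ⟨w1.reverse, a, w0.reverse, ?_, by simpa using h1, ?_⟩
  · have := congrArg List.reverse e
    simpa using this
  · intro b hb
    simpa using h2 b (by simpa using hb)

end Cong
end DAProof

/-! ### Good sets -/

namespace DAProof
open MTerm

section Main
variable {A M : Type} [Monoid M] [Finite M]

/-- `X` is a set of values in `M` of pairwise DA-equivalent ω-terms of content `B`. -/
def Good (ψ : A → M) (B : Set A) (X : Set M) : Prop :=
  ∃ r0 : MTerm A, content r0 = B ∧ ∀ x ∈ X, ∃ r : MTerm A,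
    eval ψ r = x ∧ content r = B ∧ Eqv r r0

variable {ψ : A → M}

theorem Good.subset {B : Set A} {X Y : Set M} (h : Good ψ B X) (hY : Y ⊆ X) : Good ψ B Y := by
  obtain ⟨r0, h0, h⟩ := h
  exact ⟨r0, h0, fun x hx => h x (hY hx)⟩

theorem Good.one : Good ψ ∅ {1} :=
  ⟨MTerm.one, rfl, fun x hx => ⟨MTerm.one, hx.symm, rfl, fun _ _ _ _ _ => rfl⟩⟩

theorem Good.letter (a : A) : Good ψ {a} {ψ a} :=
  ⟨MTerm.letter a, rfl, fun x hx => ⟨MTerm.letter a, hx.symm, rfl, fun _ _ _ _ _ => rfl⟩⟩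

theorem Good.mul {B C : Set A} {X Y : Set M} (hX : Good ψ B X) (hY : Good ψ C Y) :
    Good ψ (B ∪ C) (X * Y) := by
  obtain ⟨r0, h0, h⟩ := hX
  obtain ⟨s0, k0, k⟩ := hY
  refine ⟨MTerm.mul r0 s0, by rw [content, h0, k0], ?_⟩
  rintro _ ⟨x, hx, y, hy, rfl⟩
  obtain ⟨r, h1, h2, h3⟩ := h x hx
  obtain ⟨s, k1, k2, k3⟩ := k y hy
  refine ⟨MTerm.mul r s, by rw [eval, h1, k1], by rw [content, h2, k2], ?_⟩
  intro T _ _ hT f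
  rw [eval, eval, h3 T hT f, k3 T hT f]

theorem Good.listProd {B : Set A} {l : List (Set M)} (h : ∀ X ∈ l, Good ψ B X) (hl : l ≠ []) :
    Good ψ B l.prod := by
  induction l with
  | nil => exact absurd rfl hl
  | cons X l ih =>
    rw [List.prod_cons]
    by_cases hl' : l = []
    · subst hl'; simpa using h X (by simp)
    · have := (h X (by simp)).mul (ih (fun Y hY => h Y (by simp [hY])) hl')
      simpa using this

/-- Words with letters in `B`. -/
def W (ψ : A → M) (B : Set A) : Set M := {x | ∃ v : List A, (∀ a ∈ v, a ∈ B) ∧ (v.map ψ).prod = x}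

theorem mem_pow_list {X : Set M} {n : ℕ} {x : M} (h : x ∈ X ^ n) :
    ∃ l : List M, l.length = n ∧ (∀ y ∈ l, y ∈ X) ∧ l.prod = x := by
  induction n generalizing x with
  | zero => exact ⟨[], rfl, by simp, by simpa using h.symm⟩
  | succ n ih =>
    rw [pow_succ'] at h
    obtain ⟨y, hy, z, hz, rfl⟩ := h
    obtain ⟨l, h1, h2, h3⟩ := ih hz
    exact ⟨y :: l, by simp [h1], by simp only [List.mem_cons]; rintro _ (rfl | h); exacts [hy, h2 _ h],
      by simp [h3]⟩

theorem mul_pow_absorb {N : Type} [Monoid N] {p e : N} (h : p * e = p) (n : ℕ) : p * e ^ n = p := by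
  induction n with
  | zero => simp
  | succ n ih => rw [pow_succ, ← mul_assoc, ih, h]

theorem pow_mul_absorb {N : Type} [Monoid N] {p e : N} (h : e * p = p) (n : ℕ) : e ^ n * p = p := by
  induction n with
  | zero => simp
  | succ n ih => rw [pow_succ, mul_assoc, h, ih]

theorem pow_terms {B : Set A} {X : Set M} {r0 : MTerm A}
    (h : ∀ x ∈ X, ∃ r : MTerm A, eval ψ r = x ∧ content r = B ∧ Eqv r r0) {x : M}
    (hx : x ∈ X ^ Nat.card M) :
    ∃ r : MTerm A, eval ψ r = x ∧ content r = B ∧ Eqv r (omPow r0) := by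
  obtain ⟨l, hl, hlX, rfl⟩ := mem_pow_list hx
  obtain ⟨l1, l2, l3, rfl, hne, habs⟩ := pigeon_left l hl.ge
  have : ∀ l : List M, (∀ y ∈ l, y ∈ X) → ∃ m : List (MTerm A), m.length = l.length ∧
      m.map (eval ψ) = l ∧ ∀ u ∈ m, content u = B ∧ Eqv u r0 := by
    intro l hl
    induction l with
    | nil => exact ⟨[], rfl, rfl, by simp⟩
    | cons y l ih =>
      obtain ⟨m, h1, h2, h3⟩ := ih fun z hz => hl z (by simp [hz])
      obtain ⟨r, k1, k2, k3⟩ := h y (hl y (by simp))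
      refine ⟨r :: m, by simp [h1], by simp [h2, k1], ?_⟩
      intro u hu
      rcases List.mem_cons.mp hu with rfl | hu
      · exact ⟨k2, k3⟩
      · exact h3 u hu
  obtain ⟨m1, a1, b1, c1⟩ := this l1 fun y hy => hlX y (by simp [hy])
  obtain ⟨m2, a2, b2, c2⟩ := this l2 fun y hy => hlX y (by simp [hy])
  obtain ⟨m3, a3, b3, c3⟩ := this l3 fun y hy => hlX y (by simp [hy])
  have hm2 : m2 ≠ [] := by
    rintro rfl
    exact hne (by simpa using b2.symm)
  refine ⟨MTerm.mul (MTerm.mul (lprod m1) (omPow (lprod m2))) (lprod m3), ?_, ?_, ?_⟩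
  · simp only [eval, eval_lprod, b1, b2, b3, List.prod_append, habs]
    rw [om, mul_pow_absorb habs]
  · ext a
    simp only [content, Set.mem_union, content_lprod]
    constructor
    · rintro ((⟨u, hu, ha⟩ | ⟨u, hu, ha⟩) | ⟨u, hu, ha⟩)
      · rwa [(c1 u hu).1] at ha
      · rwa [(c2 u hu).1] at ha
      · rwa [(c3 u hu).1] at ha
    · intro ha
      obtain ⟨u, hu⟩ := List.exists_mem_of_ne_nil _ hm2
      exact Or.inl (Or.inr ⟨u, hu, by rwa [(c2 u hu).1]⟩)
  · intro T _ _ hT f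
    simp only [eval]
    rw [eval_lprod_const f m1 _ fun u hu => (c1 u hu).2 T hT f,
      eval_lprod_const f m2 _ fun u hu => (c2 u hu).2 T hT f,
      eval_lprod_const f m3 _ fun u hu => (c3 u hu).2 T hT f]
    obtain ⟨k, hk⟩ : ∃ k, m2.length = k + 1 :=
      Nat.exists_eq_succ_of_ne_zero (by simpa using hm2)
    rw [hk, om_pow, hT.pow_mul_om, hT.om_mul_pow]

def wordTerm (v : List A) : MTerm A := lprod (v.map MTerm.letter)

theorem eval_wordTerm (v : List A) : eval ψ (wordTerm v) = (v.map ψ).prod := by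
  simp [wordTerm, eval_lprod, Function.comp_def, eval]

theorem content_wordTerm (v : List A) : content (wordTerm v) = {a | a ∈ v} := by
  ext a
  simp [wordTerm, content_lprod, content]

theorem Good.omega {B : Set A} {X Y : Set M} (hX : Good ψ B X) (hY : Good ψ B Y) :
    Good ψ B (X ^ Nat.card M * W ψ B * Y ^ Nat.card M) := by
  obtain ⟨r0, h0, h⟩ := hX
  obtain ⟨s0, k0, k⟩ := hY
  refine ⟨MTerm.mul (omPow r0) (omPow s0), by simp [content, h0, k0], ?_⟩
  rintro _ ⟨_, ⟨x, hx, _, ⟨v, hv, rfl⟩, rfl⟩, z, hz, rfl⟩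
  obtain ⟨r, h1, h2, h3⟩ := pow_terms h hx
  obtain ⟨s, k1, k2, k3⟩ := pow_terms k hz
  have hc : content (wordTerm v) ⊆ B := by rw [content_wordTerm]; exact hv
  refine ⟨MTerm.mul (MTerm.mul r (wordTerm v)) s, by simp [eval, h1, k1, eval_wordTerm], ?_, ?_⟩
  · simp only [content, h2, k2]
    rw [Set.union_eq_left.mpr hc, Set.union_self]
  · intro T _ _ hT f
    have := om_mul_om hT f r0 s0 (wordTerm v) (h0.trans k0.symm) (by rw [h0]; exact hc)
    simp only [eval]
    rw [h3 T hT f, k3 T hT f]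
    exact this

theorem W_mul (B : Set A) : W ψ B * W ψ B ⊆ W ψ B := by
  rintro _ ⟨_, ⟨u, hu, rfl⟩, _, ⟨v, hv, rfl⟩, rfl⟩
  exact ⟨u ++ v, by simp only [List.mem_append]; rintro a (h | h); exacts [hu a h, hv a h], by simp⟩

theorem one_mem_W (B : Set A) : (1 : M) ∈ W ψ B := ⟨[], by simp, by simp⟩

theorem eval_mem_W (B : Set A) (r : MTerm A) (h : content r ⊆ B) : eval ψ r ∈ W ψ B := by
  let N : Submonoid M :=
    { carrier := W ψ B, mul_mem' := fun hx hy => W_mul B (Set.mul_mem_mul hx hy),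
      one_mem' := one_mem_W B }
  exact eval_mem ψ N r fun a ha => ⟨[a], by simpa using h ha, by simp⟩

theorem Good.subset_W {B : Set A} {X : Set M} (h : Good ψ B X) : X ⊆ W ψ B := by
  obtain ⟨r0, _, h⟩ := h
  intro x hx
  obtain ⟨r, rfl, h2, _⟩ := h x hx
  exact eval_mem_W B r h2.subset

theorem listProd_subset_W {B : Set A} {l : List (Set M)} (h : ∀ X ∈ l, Good ψ B X) :
    l.prod ⊆ W ψ B := by
  by_cases hl : l = []
  · subst hl
    rintro x rfl
    exact one_mem_W B
  · exact (Good.listProd h hl).subset_W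

theorem Good.sandwich {B : Set A} {l l' : List (Set M)} (h : ∀ X ∈ l, Good ψ B X)
    (h' : ∀ X ∈ l', Good ψ B X) (hl : Nat.card (Set M) ≤ l.length)
    (hl' : Nat.card (Set M) ≤ l'.length) :
    Good ψ B (l.prod * W ψ B * l'.prod) := by
  obtain ⟨l1, l2, l3, rfl, hne, habs⟩ := pigeon_left l hl
  obtain ⟨k1, k2, k3, rfl, kne, kabs⟩ := pigeon_right l' hl'
  have g2 : Good ψ B l2.prod := Good.listProd (fun X hX => h X (by simp [hX])) hne
  have q2 : Good ψ B k2.prod := Good.listProd (fun X hX => h' X (by simp [hX])) kne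
  have main := g2.omega q2
  have left : Good ψ B (l1.prod * (l2.prod ^ Nat.card M * W ψ B * k2.prod ^ Nat.card M)) := by
    by_cases e : l1 = []
    · subst e; simpa using main
    · have := (Good.listProd (fun X hX => h X (by simp [hX])) e).mul main
      simpa using this
  have all : Good ψ B (l1.prod * (l2.prod ^ Nat.card M * W ψ B * k2.prod ^ Nat.card M) * k3.prod) := by
    by_cases e : k3 = []
    · subst e; simpa using left
    · have := left.mul (Good.listProd (fun X hX => h' X (by simp [hX])) e)
      simpa using this
  refine all.subset ?_
  have w3 : l3.prod ⊆ W ψ B := listProd_subset_W fun X hX => h X (by simp [hX])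
  have v1 : k1.prod ⊆ W ψ B := listProd_subset_W fun X hX => h' X (by simp [hX])
  have mid : l3.prod * W ψ B * k1.prod ⊆ W ψ B :=
    (Set.mul_subset_mul ((Set.mul_subset_mul w3 subset_rfl).trans (W_mul B)) v1).trans (W_mul B)
  have e1 : (l1 ++ l2 ++ l3).prod = l1.prod * l2.prod ^ Nat.card M * l3.prod := by
    rw [List.prod_append, List.prod_append, mul_pow_absorb habs, habs]
  have e2 : (k1 ++ k2 ++ k3).prod = k1.prod * (k2.prod ^ Nat.card M * k3.prod) := by
    rw [List.prod_append, List.prod_append, pow_mul_absorb kabs, mul_assoc, kabs]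
  rw [e1, e2]
  have e3 : l1.prod * l2.prod ^ Nat.card M * l3.prod * W ψ B *
      (k1.prod * (k2.prod ^ Nat.card M * k3.prod)) =
      l1.prod * (l2.prod ^ Nat.card M * (l3.prod * W ψ B * k1.prod) * k2.prod ^ Nat.card M) *
      k3.prod := by simp only [mul_assoc]
  rw [e3]
  gcongr

/-- The set of values of the class of `w`. -/
def cls (ψ : A → M) (n : ℕ) (w : List A) : Set M := {x | ∃ v, E n v w ∧ (v.map ψ).prod = x}

def ct (w : List A) : Set A := {a | a ∈ w}

theorem cls_mono {m n : ℕ} (h : m ≤ n) (w : List A) : cls ψ n w ⊆ cls ψ m w := by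
  rintro x ⟨v, hv, rfl⟩
  exact ⟨v, hv.mono h, rfl⟩

theorem alt [Finite A] (c m : ℕ) (hm : 1 ≤ m)
    (ih : ∀ w : List A, (ct w).ncard ≤ c → Good ψ (ct w) (cls ψ m w)) (k : ℕ) :
    ∀ w : List A, (ct w).ncard = c + 1 → Good ψ (ct w) (cls ψ (m + 2 * k) w) ∨
      ∃ l l' : List (Set M), l.length = k ∧ l'.length = k ∧ (∀ X ∈ l, Good ψ (ct w) X) ∧
        (∀ X ∈ l', Good ψ (ct w) X) ∧
        cls ψ (m + 2 * k) w ⊆ l.prod * W ψ (ct w) * l'.prod := by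
  induction k with
  | zero =>
    intro w _
    refine Or.inr ⟨[], [], rfl, rfl, by simp, by simp, ?_⟩
    rintro _ ⟨v, hv, rfl⟩
    simp only [List.prod_nil, one_mul, mul_one]
    obtain ⟨m, rfl⟩ := Nat.exists_eq_add_of_le' hm
    exact ⟨v, fun a ha => (hv.mem a).mp ha, rfl⟩
  | succ k ihk =>
    intro w hw
    have hlt : ∀ w' : List A, ct w' ⊆ ct w → ct w' ≠ ct w → (ct w').ncard ≤ c := by
      intro w' h1 h2
      have := Set.ncard_lt_ncard (HasSubset.Subset.ssubset_of_ne h1 h2) (Set.toFinite _)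
      omega
    have hne : ∀ w' : List A, ct w' = ct w → w' ≠ [] := by
      rintro _ h rfl
      rw [← h] at hw
      simp [ct] at hw
    obtain ⟨w1, a, w2, e1, ha, hall⟩ := peelL (hne w rfl)
    have hw1s : ct w1 ⊆ ct w := by intro b hb; rw [e1]; exact List.mem_append_left _ hb
    have haw : a ∈ ct w := by rw [e1]; simp [ct]
    have hw1 : Good ψ (ct w1) (cls ψ m w1) := by
      refine ih w1 (hlt w1 hw1s ?_)
      intro h
      exact ha (h.symm ▸ haw : a ∈ ct w1)
    have hX : Good ψ (ct w) (cls ψ m w1 * {ψ a}) := by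
      have := hw1.mul (Good.letter a)
      have e : ct w1 ∪ {a} = ct w := by
        apply Set.Subset.antisymm
        · exact Set.union_subset hw1s (by simpa using haw)
        · intro b hb
          exact (hall b hb).imp id id
      rwa [e] at this
    have hw2s : ct w2 ⊆ ct w := by intro b hb; rw [e1]; simp only [ct, Set.mem_setOf_eq] at *; simp [hb]
    have inc1 : cls ψ (m + 2 * (k+1)) w ⊆ (cls ψ m w1 * {ψ a}) * cls ψ (m + 2 * k + 1) w2 := by
      rintro _ ⟨v, hv, rfl⟩
      rw [e1, show m + 2 * (k + 1) = (m + 2 * k + 1) + 1 by ring] at hv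
      obtain ⟨v0, v1, rfl, _, h1, h2⟩ := hv.left ha
      refine ⟨_, ⟨_, ⟨v0, h1.mono (by omega), rfl⟩, _, rfl, rfl⟩, _, ⟨v1, h2, rfl⟩, ?_⟩
      simp [mul_assoc]
    by_cases hc2 : ct w2 = ct w
    swap
    · left
      have g2 := (ih w2 (hlt w2 hw2s hc2)).subset (cls_mono (show m ≤ m + 2 * k + 1 by omega) w2)
      have := hX.mul g2
      rw [Set.union_eq_left.mpr hw2s] at this
      exact this.subset inc1
    obtain ⟨w3, b, w4, e2, hb, hall2⟩ := peelR (hne w2 hc2)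
    have hw4s : ct w4 ⊆ ct w := by
      rw [← hc2]; intro b hb; rw [e2]; simp only [ct, Set.mem_setOf_eq] at *; simp [hb]
    have hw3s : ct w3 ⊆ ct w := by
      rw [← hc2]; intro b hb; rw [e2]; simp only [ct, Set.mem_setOf_eq] at *; simp [hb]
    have hbw : b ∈ ct w := by rw [← hc2, e2]; simp [ct]
    have hw4 : Good ψ (ct w4) (cls ψ m w4) := by
      refine ih w4 (hlt w4 hw4s ?_)
      intro h
      exact hb (h.symm ▸ hbw : b ∈ ct w4)
    have hY : Good ψ (ct w) ({ψ b} * cls ψ m w4) := by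
      have := (Good.letter b).mul hw4
      have e : {b} ∪ ct w4 = ct w := by
        apply Set.Subset.antisymm
        · exact Set.union_subset (by simpa using hbw) hw4s
        · intro d hd
          rw [← hc2] at hd
          exact (hall2 d hd).symm.imp id id
      rwa [e] at this
    have inc2 : cls ψ (m + 2 * k + 1) w2 ⊆ cls ψ (m + 2 * k) w3 * ({ψ b} * cls ψ m w4) := by
      rintro _ ⟨v, hv, rfl⟩
      rw [e2] at hv
      obtain ⟨v0, v1, rfl, _, h1, h2⟩ := hv.right hb
      refine ⟨_, ⟨v0, h1, rfl⟩, _, ⟨_, rfl, _, ⟨v1, h2.mono (by omega), rfl⟩, rfl⟩, ?_⟩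
      simp
    have inc := inc1.trans (Set.mul_subset_mul_left inc2)
    have fin : Good ψ (ct w3) (cls ψ (m + 2 * k) w3) → Good ψ (ct w) (cls ψ (m + 2 * (k+1)) w) := by
      intro g3
      have := hX.mul (g3.mul hY)
      rw [Set.union_eq_right.mpr hw3s, Set.union_self] at this
      exact this.subset inc
    by_cases hc3 : ct w3 = ct w
    swap
    · exact Or.inl (fin ((ih w3 (hlt w3 hw3s hc3)).subset (cls_mono (by omega) w3)))
    rcases ihk w3 (by rw [hc3, hw]) with g | ⟨l, l', h1, h2, h3, h4, h5⟩
    · exact Or.inl (fin g)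
    · right
      rw [hc3] at h3 h4 h5
      refine ⟨(cls ψ m w1 * {ψ a}) :: l, l' ++ [{ψ b} * cls ψ m w4], by simp [h1], by simp [h2],
        ?_, ?_, ?_⟩
      · intro X hX'
        rcases List.mem_cons.mp hX' with rfl | hX'
        exacts [hX, h3 X hX']
      · intro X hX'
        rcases List.mem_append.mp hX' with hX' | hX'
        · exact h4 X hX'
        · rw [List.mem_singleton.mp hX']; exact hY
      · refine inc.trans ((Set.mul_subset_mul_left (Set.mul_subset_mul_right h5)).trans ?_)
        rw [List.prod_cons, List.prod_append, List.prod_singleton]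
        simp only [mul_assoc]
        exact subset_rfl

theorem main_good [Finite A] (ψ : A → M) (c : ℕ) :
    ∃ m, 1 ≤ m ∧ ∀ w : List A, (ct w).ncard ≤ c → Good ψ (ct w) (cls ψ m w) := by
  induction c with
  | zero =>
    refine ⟨1, le_rfl, fun w hw => ?_⟩
    have h0 : ct w = ∅ := (Set.ncard_eq_zero (Set.toFinite _)).mp (by omega)
    rw [h0]
    refine Good.one.subset ?_
    rintro _ ⟨v, hv, rfl⟩
    have : v = [] := by
      apply List.eq_nil_iff_forall_not_mem.mpr
      intro a ha
      have : a ∈ ct w := (hv.mem a).mp ha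
      simp [h0] at this
    simp [this]
  | succ c ih =>
    obtain ⟨m, hm, h⟩ := ih
    refine ⟨m + 2 * Nat.card (Set M), by omega, fun w hw => ?_⟩
    rcases Nat.lt_or_ge c (ct w).ncard with hlt | hle
    · rcases alt c m hm h (Nat.card (Set M)) w (by omega) with g | ⟨l, l', h1, h2, h3, h4, h5⟩
      · exact g
      · exact (Good.sandwich h3 h4 h1.ge h2.ge).subset h5
    · exact (h w hle).subset (cls_mono (by omega) w)

end Main

theorem withOne_DA {T : Type} [Semigroup T] (h : InDA T) : DAm (WithOne T) := by
  have key : ∀ t : T, (∃ x : WithOne T, (t : WithOne T) = t * x * t) → t * t = t := by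
    rintro t ⟨x, hx⟩
    by_cases h1 : x = 1
    · rw [h1, mul_one, ← WithOne.coe_mul] at hx
      exact (WithOne.coe_injective hx).symm
    · obtain ⟨y, rfl⟩ := WithOne.ne_one_iff_exists.mp h1
      rw [← WithOne.coe_mul, ← WithOne.coe_mul] at hx
      exact h t ⟨y, WithOne.coe_injective hx⟩
  intro t ht
  by_cases h1 : t = 1
  · rw [h1, mul_one]
  · obtain ⟨y, rfl⟩ := WithOne.ne_one_iff_exists.mp h1
    rw [← WithOne.coe_mul, key y ht]

end DAProof

open DAProof

/-- The pseudovariety `DA` is ω-reducible for pointlike sets. -/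
theorem DA_omega_reducible_for_pointlikes
    {S : Type} [Semigroup S] [Finite S]
    (P : Set S) (hP : IsDAPointlike P)
    (A : Type) [Finite A]
    (φ : FreeSemigroup A →ₙ* S) (hφ : Function.Surjective φ) :
    ∃ w : P → OTerm A,
      (∀ p : P, OEval (fun a => φ (FreeSemigroup.of a)) (w p) (p : S)) ∧
      (∀ (T : Type) [Semigroup T] [Finite T], InDA T →
        ∀ f : A → T, ∃ t : T, ∀ p : P, OEval f (w p) t) := by
  classical
  rcases P.eq_empty_or_nonempty with rfl | ⟨p0, hp0⟩
  · have hA : Nonempty A := by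
      by_contra hA
      rw [not_nonempty_iff] at hA
      have hS : IsEmpty S := by
        constructor
        intro s
        obtain ⟨w, _⟩ := hφ s
        exact hA.elim w.head
      obtain ⟨t, _⟩ := hP S (fun t => hS.elim t) ⊤ (fun s => hS.elim s)
      exact hS.elim t
    exact ⟨fun p => p.2.elim, fun p => p.2.elim,
      fun T _ _ _ f => ⟨f hA.some, fun p => p.2.elim⟩⟩
  let ψ : A → WithOne S := fun a => ((φ (FreeSemigroup.of a) : S) : WithOne S)
  obtain ⟨m, _, hgood⟩ := main_good ψ (Nat.card A)
  let g : FreeSemigroup A →ₙ* FreeMonoid A := FreeSemigroup.lift FreeMonoid.of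
  have hg : ∀ w : FreeSemigroup A, ((g w).toList.map ψ).prod = ((φ w : S) : WithOne S) := by
    intro w
    induction w using FreeSemigroup.recOnMul with
    | ih1 a => simp [g, ψ]
    | ih2 a w h1 h2 =>
      rw [map_mul, FreeMonoid.toList_mul, List.map_append, List.prod_append, h1, h2,
        map_mul, WithOne.coe_mul]
  have := finite_con (A := A) m
  obtain ⟨t, ht⟩ := hP (con A m).Quotient (con_DA m)
    (φ.prod (((con A m).mk' : FreeMonoid A →ₙ* (con A m).Quotient).comp g)).srange (by
      intro s
      obtain ⟨w, rfl⟩ := hφ s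
      exact ⟨_, w, rfl⟩)
  have ht' : ∀ p ∈ P, ∃ w : FreeSemigroup A, φ w = p ∧ ((g w : FreeMonoid A) : (con A m).Quotient) = t := by
    intro p hp
    obtain ⟨w, hw⟩ := ht p hp
    exact ⟨w, congrArg Prod.fst hw, congrArg Prod.snd hw⟩
  obtain ⟨w0, _, hw0⟩ := ht' p0 hp0
  obtain ⟨r0, _, hr⟩ := hgood (g w0).toList (Set.ncard_le_card _)
  have hterm : ∀ p : P, ∃ r : MTerm A, r.eval ψ = ((p : S) : WithOne S) ∧ r.Eqv r0 := by
    rintro ⟨p, hp⟩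
    obtain ⟨w, hw1, hw2⟩ := ht' p hp
    obtain ⟨r, h1, _, h3⟩ := hr p ⟨(g w).toList, (Con.eq _).mp (hw2.trans hw0.symm), by rw [hg, hw1]⟩
    exact ⟨r, h1, h3⟩
  choose r hr1 hr2 using hterm
  have hred : ∀ p : P, ∃ o : OTerm A, (r p).red = some o ∧
      OEval (fun a => φ (FreeSemigroup.of a)) o (p : S) := by
    intro p
    rcases MTerm.red_spec (fun a => φ (FreeSemigroup.of a)) (r p) with ⟨_, h⟩ | ⟨o, x, h1, h2, h3⟩
    · exact absurd ((hr1 p).symm.trans h) WithOne.coe_ne_one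
    · have : x = (p : S) := WithOne.coe_injective (h2.symm.trans (hr1 p))
      exact ⟨o, h1, this ▸ h3⟩
  choose o ho1 ho2 using hred
  refine ⟨o, ho2, ?_⟩
  intro T _ _ hT f
  have key : ∀ p : P, ∃ x : T, r0.eval (fun a => (f a : WithOne T)) = (x : WithOne T) ∧
      OEval f (o p) x := by
    intro p
    rcases MTerm.red_spec f (r p) with ⟨h, _⟩ | ⟨o', x, h1, h2, h3⟩
    · rw [ho1 p] at h; cases h
    · rw [ho1 p] at h1
      cases h1
      exact ⟨x, by rw [← hr2 p _ (withOne_DA hT), h2], h3⟩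
  obtain ⟨x, hx, _⟩ := key ⟨p0, hp0⟩
  refine ⟨x, fun p => ?_⟩
  obtain ⟨y, hy, h⟩ := key p
  have : y = x := WithOne.coe_injective (hy.symm.trans hx)
  exact this ▸ h
end
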